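/- arXiv:1703.03955 — 4 statements merged into one kernel-verified Lean document; each statement's English description precedes it below -/
import Mathlib

section
/- Let n ≥ 5 and W = S_{n+1}. Let I = R − {s_i} with 2 ≤ i ≤ n−1 and J = R − {s_1, s_j} with 2 < j ≤ i, and let τ₀ = (i, i−1, ..., i−j+1, n+1, n, ..., i+1, i−j, ..., 1) be the minimal element of X⁺_{I,J}. Define w ∈ W by: w(1) = i, w(2) = n+1, w(k) = i+2−k for 3 ≤ k ≤ j, w(k) = n+j+1−k for j+1 ≤ k ≤ j+n−i, and w(k) = n+2−k for j+n−i+1 ≤ k ≤ n+1 (so w = (i, n+1, i−1, ..., i−j+2, n, ..., i+1, i−j+1, i−j, ..., 1)). Then w is the unique element of X⁺_{I,J} that covers τ₀ in the restriction of the Bruhat order to X⁺_{I,J}. -/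
/-- The number of inversions (Coxeter length) of a permutation of `Fin m`. -/
def sLen {m : ℕ} (w : Equiv.Perm (Fin m)) : ℕ :=
  (Finset.univ.filter fun p : Fin m × Fin m => p.1 < p.2 ∧ w p.2 < w p.1).card

/-- The Bruhat order on the symmetric group: generated by `w < t * w` for a
transposition `t` with `sLen (t * w) > sLen w`. -/
def bruhatLE {m : ℕ} (u v : Equiv.Perm (Fin m)) : Prop :=
  Relation.ReflTransGen
    (fun x y => (∃ a b : Fin m, a ≠ b ∧ y = Equiv.swap a b * x) ∧ sLen x < sLen y) u v

/-- The right descent set of `w`, as a set of indices of simple reflections: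
`i : Fin n` stands for the simple transposition `s_{i+1} = (i+1, i+2)` (1-based). -/
def Des {n : ℕ} (w : Equiv.Perm (Fin (n + 1))) : Set (Fin n) :=
  {i | w i.succ < w i.castSucc}

/-- Maximal-length double-coset representatives:
`X⁺_{I,J} = {w : I ⊆ Des (w⁻¹) ∧ J ⊆ Des w}`. -/
def Xplus {n : ℕ} (I J : Set (Fin n)) : Set (Equiv.Perm (Fin (n + 1))) :=
  {w | I ⊆ Des w⁻¹ ∧ J ⊆ Des w}

/-- A subset of the symmetric group is totally ordered (a chain) in Bruhat order. -/
def IsChainOn {m : ℕ} (X : Set (Equiv.Perm (Fin m))) : Prop :=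
  ∀ x ∈ X, ∀ y ∈ X, bruhatLE x y ∨ bruhatLE y x

/-- A subset of the symmetric group, with the restriction of the Bruhat order,
is a lattice: every pair has a least upper bound and a greatest lower bound in the set. -/
def IsLatticeOn {m : ℕ} (X : Set (Equiv.Perm (Fin m))) : Prop :=
  (∀ x ∈ X, ∀ y ∈ X, ∃ z ∈ X, bruhatLE x z ∧ bruhatLE y z ∧
      ∀ t ∈ X, bruhatLE x t → bruhatLE y t → bruhatLE z t) ∧
  (∀ x ∈ X, ∀ y ∈ X, ∃ z ∈ X, bruhatLE z x ∧ bruhatLE z y ∧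
      ∀ t ∈ X, bruhatLE t x → bruhatLE t y → bruhatLE t z)

/-- `y` covers `x` in the restriction of the Bruhat order to `X`. -/
def CoversIn {m : ℕ} (X : Set (Equiv.Perm (Fin m))) (x y : Equiv.Perm (Fin m)) : Prop :=
  x ∈ X ∧ y ∈ X ∧ bruhatLE x y ∧ x ≠ y ∧
    ∀ z ∈ X, bruhatLE x z → bruhatLE z y → z = x ∨ z = y

/-- The number of positions `r < k` at which the value of `w` is at least `a`. -/
def bruhatRank {m : ℕ} (w : Equiv.Perm (Fin m)) (k a : ℕ) : ℕ :=
  (Finset.univ.filter fun r : Fin m => (r : ℕ) < k ∧ a ≤ (w r : ℕ)).card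

theorem sLen_lt_sLen_mul_swap {m : ℕ} (u : Equiv.Perm (Fin m)) {p q : Fin m}
    (hpq : p < q) (hu : u p < u q) : sLen u < sLen (u * Equiv.swap p q) := by
  have hσσ : ∀ a, Equiv.swap p q (Equiv.swap p q a) = a := Equiv.swap_apply_self p q
  have hσ : ∀ a, (a = p ∧ Equiv.swap p q a = q) ∨ (a = q ∧ Equiv.swap p q a = p) ∨
      (a ≠ p ∧ a ≠ q ∧ Equiv.swap p q a = a) := by
    intro a
    by_cases h1 : a = p
    · simp [h1]
    by_cases h2 : a = q
    · simp [h2]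
    · simp [h1, h2, Equiv.swap_apply_of_ne_of_ne]
  have hp : Equiv.swap p q p = q := Equiv.swap_apply_left p q
  have hq : Equiv.swap p q q = p := Equiv.swap_apply_right p q
  generalize hs : Equiv.swap p q = σ at *
  let f : Fin m × Fin m → Fin m × Fin m := fun x =>
    if σ x.1 < σ x.2 then (σ x.1, σ x.2) else x
  unfold sLen
  rw [← Finset.card_image_of_injOn (f := f)]
  · apply Finset.card_lt_card
    rw [Finset.ssubset_iff_of_subset]
    · refine ⟨(p, q), Finset.mem_filter.2
        ⟨Finset.mem_univ _, hpq, by simpa [hp, hq] using hu⟩, ?_⟩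
      simp only [Finset.mem_image, Finset.mem_filter, Finset.mem_univ, true_and, Prod.exists, f]
      rintro ⟨a, b, ⟨hab, hba⟩, h⟩
      split_ifs at h <;> grind
    · intro x hx
      simp only [Finset.mem_image, Finset.mem_filter, Finset.mem_univ, true_and, Prod.exists,
        f] at hx
      obtain ⟨a, b, ⟨hab, hba⟩, rfl⟩ := hx
      have ha := hσ a
      have hb := hσ b
      split_ifs with h
      · exact Finset.mem_filter.2 ⟨Finset.mem_univ _, h, by simpa [hσσ] using hba⟩
      · refine Finset.mem_filter.2 ⟨Finset.mem_univ _, hab, ?_⟩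
        simp only [Equiv.Perm.coe_mul, Function.comp_apply]
        grind
  · rintro ⟨a, b⟩ hx ⟨c, d⟩ hy h
    simp only [Finset.coe_filter, Finset.mem_univ, true_and, Set.mem_ofPred_eq] at hx hy
    simp only [f] at h
    split_ifs at h <;> grind

theorem bruhatLE.eq_or_sLen_lt {m : ℕ} {u v : Equiv.Perm (Fin m)} (h : bruhatLE u v) :
    u = v ∨ sLen u < sLen v := by
  induction h with
  | refl => exact Or.inl rfl
  | tail _ h ih =>
    right
    rcases ih with rfl | ih
    · exact h.2
    · exact ih.trans h.2

theorem bruhatLE.antisymm {m : ℕ} {u v : Equiv.Perm (Fin m)} (h : bruhatLE u v)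
    (h' : bruhatLE v u) : u = v := by
  rcases h.eq_or_sLen_lt with h | h
  · exact h
  rcases h'.eq_or_sLen_lt with h' | h'
  · exact h'.symm
  · omega

theorem bruhatRank_mul_swap_le {m : ℕ} (u : Equiv.Perm (Fin m)) {p q : Fin m}
    (hpq : p < q) (hu : u p < u q) (k a : ℕ)
    (h : ¬ ((p : ℕ) < k ∧ k ≤ q ∧ (u p : ℕ) < a ∧ a ≤ u q)) :
    bruhatRank (u * Equiv.swap p q) k a ≤ bruhatRank u k a := by
  unfold bruhatRank
  by_cases hk : (q : ℕ) < k
  · refine Finset.card_le_card_of_injOn (Equiv.swap p q) ?_ (Equiv.injective _).injOn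
    intro r hr
    simp only [Finset.coe_filter, Finset.mem_univ, true_and, Set.mem_ofPred_eq] at hr ⊢
    simp only [Equiv.Perm.coe_mul, Function.comp_apply] at hr
    refine ⟨?_, hr.2⟩
    rw [Equiv.swap_apply_def]
    split_ifs <;> omega
  · apply Finset.card_le_card
    intro r hr
    simp only [Finset.mem_filter, Finset.mem_univ, true_and] at hr ⊢
    simp only [Equiv.Perm.coe_mul, Function.comp_apply] at hr
    refine ⟨hr.1, ?_⟩
    rw [Equiv.swap_apply_def] at hr
    split_ifs at hr with h1 h2
    · subst h1; omega
    · subst h2; omega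
    · exact hr.2

theorem bruhatRank_mul_swap_le_succ {m : ℕ} (u : Equiv.Perm (Fin m)) {p q : Fin m}
    (k a : ℕ) (hk : k ≤ q) :
    bruhatRank (u * Equiv.swap p q) k a ≤ bruhatRank u k a + 1 := by
  unfold bruhatRank
  refine le_trans (Finset.card_le_card ?_) (Finset.card_insert_le p _)
  intro r hr
  simp only [Finset.mem_insert, Finset.mem_filter, Finset.mem_univ, true_and] at hr ⊢
  simp only [Equiv.Perm.coe_mul, Function.comp_apply] at hr
  rw [Equiv.swap_apply_def] at hr
  split_ifs at hr with h1 h2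
  · exact Or.inl h1
  · subst h2; omega
  · exact Or.inr hr

theorem exists_swap_of_bruhatRank_le {m : ℕ} {u v : Equiv.Perm (Fin m)} (huv : u ≠ v)
    (h : ∀ k a, bruhatRank u k a ≤ bruhatRank v k a) :
    ∃ p q, p < q ∧ u p < u q ∧
      ∀ k a, bruhatRank (u * Equiv.swap p q) k a ≤ bruhatRank v k a := by
  obtain ⟨p, hp, hpmin⟩ := wellFounded_lt.has_min {p | u p ≠ v p} (by
    by_contra hne
    exact huv (Equiv.ext fun x => by
      by_contra hx
      exact hne ⟨x, hx⟩))
  have hagree : ∀ r < p, u r = v r := fun r hr => by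
    by_contra hne
    exact hpmin r hne hr
  have hlt : u p < v p := by
    by_contra hle
    have hvu : v p < u p := lt_of_le_of_ne (not_lt.1 hle) (Ne.symm hp)
    refine absurd (h (p + 1) (u p)) (not_le.2 (Finset.card_lt_card ?_))
    rw [Finset.ssubset_iff_of_subset]
    · exact ⟨p, by simp, by simpa using hvu⟩
    · intro r hr
      simp only [Finset.mem_filter, Finset.mem_univ, true_and] at hr ⊢
      rcases lt_or_eq_of_le (show r ≤ p by omega) with hrp | rfl
      · rw [hagree r hrp]; exact hr
      · omega
  obtain ⟨q, ⟨hpq, hupq, huqv⟩, hqmin⟩ :=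
    wellFounded_lt.has_min {q | p < q ∧ u p < u q ∧ u q ≤ v p} (by
      refine ⟨u.symm (v p), ?_, by simpa using hlt, by simp⟩
      by_contra hle
      rcases lt_or_eq_of_le (not_lt.1 hle) with hlt' | heq
      · have := hagree _ hlt'
        rw [Equiv.apply_symm_apply, v.injective.eq_iff] at this
        exact hlt'.ne this.symm
      · rw [Equiv.symm_apply_eq] at heq
        exact hp heq.symm)
  refine ⟨p, q, hpq, hupq, fun k a => ?_⟩
  by_cases hc : (p : ℕ) < k ∧ k ≤ q ∧ (u p : ℕ) < a ∧ a ≤ u q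
  · obtain ⟨hpk, hkq, hpa, haq⟩ := hc
    refine (bruhatRank_mul_swap_le_succ u k a hkq).trans ?_
    have split : ∀ x : Equiv.Perm (Fin m), bruhatRank x k a =
        (Finset.univ.filter fun r : Fin m =>
          (r : ℕ) < k ∧ a ≤ (x r : ℕ) ∧ (x r : ℕ) ≤ v p).card +
        bruhatRank x k (v p + 1) := by
      intro x
      unfold bruhatRank
      rw [← Finset.card_union_of_disjoint]
      · congr 1
        ext r
        simp only [Finset.mem_filter, Finset.mem_univ, true_and, Finset.mem_union]
        omega
      · rw [Finset.disjoint_filter]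
        intros
        omega
    rw [split u, split v]
    have hlow : (Finset.univ.filter fun r : Fin m =>
          (r : ℕ) < k ∧ a ≤ (u r : ℕ) ∧ (u r : ℕ) ≤ v p).card <
        (Finset.univ.filter fun r : Fin m =>
          (r : ℕ) < k ∧ a ≤ (v r : ℕ) ∧ (v r : ℕ) ≤ v p).card := by
      apply Finset.card_lt_card
      rw [Finset.ssubset_iff_of_subset]
      · refine ⟨p, ?_, ?_⟩ <;> simp <;> omega
      · intro r hr
        simp only [Finset.mem_filter, Finset.mem_univ, true_and] at hr ⊢
        rcases lt_trichotomy r p with hrp | rfl | hrp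
        · rw [← hagree r hrp]; exact hr
        · omega
        · exact absurd (show r < q by omega)
            (hqmin r ⟨hrp, by omega, by omega⟩)
    have := h k (v p + 1)
    omega
  · exact (bruhatRank_mul_swap_le u hpq hupq k a hc).trans (h k a)

/-- The rank-matrix criterion for the Bruhat order. -/
theorem bruhatLE_of_bruhatRank_le {m : ℕ} {u v : Equiv.Perm (Fin m)}
    (h : ∀ k a, bruhatRank u k a ≤ bruhatRank v k a) : bruhatLE u v := by
  have hbound : ∀ x : Equiv.Perm (Fin m), sLen x ≤ Fintype.card (Fin m × Fin m) :=
    fun x => Finset.card_le_univ _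
  induction hd : Fintype.card (Fin m × Fin m) - sLen u using Nat.strong_induction_on
    generalizing u with
  | _ d ih =>
    by_cases huv : u = v
    · subst huv
      exact Relation.ReflTransGen.refl
    obtain ⟨p, q, hpq, hu, hle⟩ := exists_swap_of_bruhatRank_le huv h
    have hlen := sLen_lt_sLen_mul_swap u hpq hu
    have := hbound (u * Equiv.swap p q)
    refine Relation.ReflTransGen.head ⟨⟨u p, u q, hu.ne, ?_⟩, hlen⟩
      (ih _ (by omega) hle rfl)
    rw [Equiv.mul_swap_eq_swap_mul]

/-- If the values of `u` in `[lo, hi)` occur in decreasing order, then those among the first `k`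
positions are the largest ones. -/
theorem card_filter_eq_min_of_antitone {m : ℕ} (u : Equiv.Perm (Fin m)) {lo hi a : ℕ}
    (hanti : ∀ r s : Fin m, lo ≤ (u r : ℕ) → u r < u s → (u s : ℕ) < hi → s < r)
    (hla : lo ≤ a) (hhi : hi ≤ m) (k : ℕ) :
    (Finset.univ.filter fun r : Fin m => (r : ℕ) < k ∧ a ≤ (u r : ℕ) ∧ (u r : ℕ) < hi).card =
      min (Finset.univ.filter fun r : Fin m =>
        (r : ℕ) < k ∧ lo ≤ (u r : ℕ) ∧ (u r : ℕ) < hi).card (hi - a) := by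
  have hcard : (Finset.univ.filter fun r : Fin m => a ≤ (u r : ℕ) ∧ (u r : ℕ) < hi).card
      = hi - a := by
    rw [← Nat.card_Ico a hi]
    refine Finset.card_bij (fun r _ => (u r : ℕ)) ?_ ?_ ?_
    · intro r hr
      simpa using hr
    · intro r _ s _ hrs
      exact u.injective (Fin.ext hrs)
    · intro b hb
      rw [Finset.mem_Ico] at hb
      exact ⟨u.symm ⟨b, by omega⟩, by simpa using hb, by simp⟩
  rw [← hcard]
  by_cases hsub : ∀ r : Fin m, a ≤ (u r : ℕ) → (u r : ℕ) < hi → (r : ℕ) < k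
  · rw [min_eq_right]
    · congr 1
      ext r
      simp only [Finset.mem_filter, Finset.mem_univ, true_and]
      exact ⟨fun h => h.2, fun h => ⟨hsub r h.1 h.2, h⟩⟩
    · apply Finset.card_le_card
      intro r hr
      simp only [Finset.mem_filter, Finset.mem_univ, true_and] at hr ⊢
      exact ⟨hsub r hr.1 hr.2, by omega, hr.2⟩
  · push Not at hsub
    obtain ⟨s, has, hsh, hks⟩ := hsub
    have hall : ∀ r : Fin m, (r : ℕ) < k → lo ≤ (u r : ℕ) → (u r : ℕ) < hi →
        a ≤ (u r : ℕ) := by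
      intro r hr hlo _
      by_contra hlt
      have := hanti r s hlo (by omega) hsh
      omega
    rw [min_eq_left]
    · congr 1
      ext r
      simp only [Finset.mem_filter, Finset.mem_univ, true_and]
      exact ⟨fun h => ⟨h.1, by omega, h.2.2⟩, fun h => ⟨h.1, hall r h.1 h.2.1 h.2.2, h.2.2⟩⟩
    · apply Finset.card_le_card
      intro r hr
      simp only [Finset.mem_filter, Finset.mem_univ, true_and] at hr ⊢
      exact ⟨hall r hr.1 hr.2.1 hr.2.2, hr.2.2⟩

/-- The values below `i` occur in decreasing order in `u`, and so do the values from `i` on. -/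
def IsTwoDecreasing {m : ℕ} (i : ℕ) (u : Equiv.Perm (Fin m)) : Prop :=
  ∀ r s : Fin m, u r < u s → ((u s : ℕ) < i ∨ i ≤ (u r : ℕ)) → s < r

theorem bruhatRank_of_le {m i : ℕ} {u : Equiv.Perm (Fin m)} (hu : IsTwoDecreasing i u)
    {a : ℕ} (ha : i ≤ a) (k : ℕ) : bruhatRank u k a = min (bruhatRank u k i) (m - a) := by
  have := card_filter_eq_min_of_antitone u (lo := i) (hi := m) (a := a)
    (fun r s h1 h2 _ => hu r s h2 (Or.inr h1)) ha le_rfl k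
  simp only [Fin.is_lt, and_true] at this
  unfold bruhatRank
  convert this

theorem bruhatRank_of_ge {m i : ℕ} {u : Equiv.Perm (Fin m)} (hu : IsTwoDecreasing i u)
    (him : i ≤ m) {a : ℕ} (ha : a ≤ i) (k : ℕ) :
    bruhatRank u k a = min (bruhatRank u k 0) (bruhatRank u k i + (i - a)) := by
  have key := card_filter_eq_min_of_antitone u (lo := 0) (hi := i) (a := a)
    (fun r s _ h2 h3 => hu r s h2 (Or.inl h3)) (Nat.zero_le _) him k
  have split : ∀ b ≤ i, bruhatRank u k b = bruhatRank u k i +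
      (Finset.univ.filter fun r : Fin m =>
        (r : ℕ) < k ∧ b ≤ (u r : ℕ) ∧ (u r : ℕ) < i).card := by
    intro b hb
    unfold bruhatRank
    rw [← Finset.card_union_of_disjoint]
    · congr 1
      ext r
      simp only [Finset.mem_filter, Finset.mem_univ, true_and, Finset.mem_union]
      omega
    · rw [Finset.disjoint_filter]
      intros
      omega
  rw [split a ha, split 0 (Nat.zero_le _), key]
  omega

theorem bruhatRank_zero {m : ℕ} (u v : Equiv.Perm (Fin m)) (k : ℕ) :
    bruhatRank u k 0 = bruhatRank v k 0 := by
  simp [bruhatRank]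

theorem bruhatLE_of_isTwoDecreasing {m i : ℕ} {u v : Equiv.Perm (Fin m)}
    (hu : IsTwoDecreasing i u) (hv : IsTwoDecreasing i v) (him : i ≤ m)
    (h : ∀ k, bruhatRank u k i ≤ bruhatRank v k i) : bruhatLE u v := by
  apply bruhatLE_of_bruhatRank_le
  intro k a
  have := h k
  rcases le_total i a with ha | ha
  · rw [bruhatRank_of_le hu ha, bruhatRank_of_le hv ha]
    omega
  · rw [bruhatRank_of_ge hu him ha, bruhatRank_of_ge hv him ha, bruhatRank_zero u v]
    omega

theorem bruhatRank_succ_le {m : ℕ} (u : Equiv.Perm (Fin m)) (k a : ℕ) :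
    bruhatRank u (k + 1) a ≤ bruhatRank u k a + 1 := by
  by_cases hk : k < m
  · refine le_trans (Finset.card_le_card ?_) (Finset.card_insert_le ⟨k, hk⟩ _)
    intro r hr
    simp only [Finset.mem_insert, Finset.mem_filter, Finset.mem_univ, true_and,
      Fin.ext_iff] at hr ⊢
    omega
  · refine (Finset.card_le_card ?_).trans (Nat.le_succ _)
    intro r hr
    simp only [Finset.mem_filter, Finset.mem_univ, true_and] at hr ⊢
    omega

theorem bruhatRank_succ_of_le {m : ℕ} (u : Equiv.Perm (Fin m)) {k : Fin m} {a : ℕ}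
    (h : a ≤ (u k : ℕ)) : bruhatRank u (k + 1) a = bruhatRank u k a + 1 := by
  refine le_antisymm (bruhatRank_succ_le u k a) (Finset.card_lt_card ?_)
  rw [Finset.ssubset_iff_of_subset]
  · exact ⟨k, by simpa using h, by simp⟩
  · intro r hr
    simp only [Finset.mem_filter, Finset.mem_univ, true_and] at hr ⊢
    omega

theorem bruhatRank_le_sub {m : ℕ} (u : Equiv.Perm (Fin m)) (k a : ℕ) :
    bruhatRank u k a ≤ m - a := by
  rw [← Nat.card_Ico a m]
  refine Finset.card_le_card_of_injOn (fun r => (u r : ℕ)) ?_ ?_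
  · intro r hr
    simp only [Finset.coe_filter, Finset.mem_univ, true_and, Set.mem_ofPred_eq] at hr
    simpa using hr.2
  · intro r _ s _ hrs
    exact u.injective (Fin.ext hrs)

theorem bruhatRank_eq_sub {m : ℕ} (u : Equiv.Perm (Fin m)) {k a : ℕ}
    (h : ∀ r : Fin m, k ≤ r → (u r : ℕ) < a) : bruhatRank u k a = m - a := by
  refine le_antisymm (bruhatRank_le_sub u k a) ?_
  rw [← Nat.card_Ico a m]
  refine Finset.card_le_card_of_surjOn (fun r => (u r : ℕ)) ?_
  intro b hb
  rw [Finset.coe_Ico, Set.mem_Ico] at hb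
  refine ⟨u.symm ⟨b, hb.2⟩, ?_, by simp⟩
  simp only [Finset.coe_filter, Finset.mem_univ, true_and, Set.mem_ofPred_eq,
    Equiv.apply_symm_apply]
  refine ⟨?_, hb.1⟩
  by_contra hlt
  have := h _ (not_lt.1 hlt)
  simp only [Equiv.apply_symm_apply] at this
  omega

theorem bruhatRank_eq_zero {m : ℕ} (u : Equiv.Perm (Fin m)) {k a : ℕ}
    (h : ∀ r : Fin m, (r : ℕ) < k → (u r : ℕ) < a) : bruhatRank u k a = 0 := by
  rw [bruhatRank, Finset.card_eq_zero, Finset.filter_eq_empty_iff]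
  rintro r - ⟨h1, h2⟩
  have := h r h1
  omega

theorem bruhatRank_pos {m : ℕ} (u : Equiv.Perm (Fin m)) {k a : ℕ} {r : Fin m}
    (hr : (r : ℕ) < k) (h : a ≤ (u r : ℕ)) : 0 < bruhatRank u k a :=
  Finset.card_pos.2 ⟨r, by simp [hr, h]⟩

/-- A sequence on `Fin m` with a descent at every position in `[b, c)` is decreasing on
`[b, c]`. -/
theorem lt_of_succ_lt {m b c : ℕ} {α : Type*} [Preorder α] {f : Fin m → α}
    (h : ∀ k (hk : k + 1 < m), b ≤ k → k < c → f ⟨k + 1, hk⟩ < f ⟨k, by omega⟩)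
    {r s : Fin m} (hr : b ≤ (r : ℕ)) (hrs : r < s) (hs : (s : ℕ) ≤ c) : f s < f r := by
  obtain ⟨s, hsm⟩ := s
  rw [Fin.lt_def] at hrs
  simp only at hrs hs
  induction s, hrs using Nat.le_induction with
  | base => exact h r hsm hr (by omega)
  | succ k hk ih => exact (h k hsm (by omega) (by omega)).trans (ih (by omega) (by omega))

theorem bruhatRank_le_of_le {m i j : ℕ} {u v : Equiv.Perm (Fin m)}
    (hv : ∀ r s : Fin m, j ≤ (r : ℕ) → r < s → v s < v r)
    (h : ∀ k ≤ j, bruhatRank u k i ≤ bruhatRank v k i) (k : ℕ) :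
    bruhatRank u k i ≤ bruhatRank v k i := by
  rcases le_total k j with hk | hk
  · exact h k hk
  induction k, hk using Nat.le_induction with
  | base => exact h j le_rfl
  | succ k hk ih =>
    by_cases hbig : ∃ hkm : k < m, i ≤ (v ⟨k, hkm⟩ : ℕ)
    · obtain ⟨hkm, hbig⟩ := hbig
      have h1 := bruhatRank_succ_of_le v hbig
      have h2 := bruhatRank_succ_le u k i
      simp only at h1
      omega
    · rw [bruhatRank_eq_sub v]
      · exact bruhatRank_le_sub u _ _
      · intro r hr
        by_contra hlt
        have hkm : k < m := by omega
        have := hv ⟨k, hkm⟩ r hk (by rw [Fin.lt_def]; simp only; omega)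
        exact hbig ⟨hkm, by omega⟩

theorem isTwoDecreasing_of_subset_Des {n i : ℕ} (hi : 1 ≤ i) (hin : i ≤ n)
    {u : Equiv.Perm (Fin (n + 1))}
    (h : ({⟨i - 1, by omega⟩} : Set (Fin n))ᶜ ⊆ Des u⁻¹) : IsTwoDecreasing i u := by
  have hstep : ∀ k (hk : k + 1 < n + 1), k ≠ i - 1 → u⁻¹ ⟨k + 1, hk⟩ < u⁻¹ ⟨k, by omega⟩ :=
    fun k hk hki => @h ⟨k, by omega⟩ (by simpa [Fin.ext_iff] using hki)
  intro r s hrs hor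
  have key : u⁻¹ (u s) < u⁻¹ (u r) := by
    rcases hor with h1 | h1
    · exact lt_of_succ_lt (b := 0) (c := i - 1) (fun k hk _ _ => hstep k hk (by omega))
        (Nat.zero_le _) hrs (by omega)
    · exact lt_of_succ_lt (b := i) (c := n) (fun k hk _ _ => hstep k hk (by omega))
        h1 hrs (by omega)
  simpa using key

theorem mem_Xplus_compl {n i j : ℕ} (hi : i - 1 < n) (hj : j - 1 < n)
    {u : Equiv.Perm (Fin (n + 1))}
    (h1 : ∀ r s : Fin (n + 1), (u s : ℕ) = u r + 1 → (u r : ℕ) ≠ i - 1 → s < r)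
    (h2 : ∀ r s : Fin (n + 1), (s : ℕ) = r + 1 → (r : ℕ) ≠ 0 → (r : ℕ) ≠ j - 1 → u s < u r) :
    u ∈ Xplus ({⟨i - 1, hi⟩} : Set (Fin n))ᶜ
      ({⟨0, by omega⟩, ⟨j - 1, hj⟩} : Set (Fin n))ᶜ := by
  constructor
  · intro v hv
    refine h1 _ _ (by simp) ?_
    simpa [Fin.ext_iff] using hv
  · intro k hk
    simp only [Set.mem_compl_iff, Set.mem_insert_iff, Set.mem_singleton_iff, Fin.ext_iff,
      not_or] at hk
    exact h2 _ _ (by simp) hk.1 hk.2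

/-- Let `n ≥ 5`, `I = R − {s_i}` with `2 ≤ i ≤ n−1`, `J = R − {s_1, s_j}` with
`2 < j ≤ i` (all 1-based), and let
`τ₀ = (i, i−1, ..., i−j+1, n+1, n, ..., i+1, i−j, ..., 1)` be the minimal element
of `X⁺_{I,J}`.  Let `w = (i, n+1, i−1, ..., i−j+2, n, ..., i+1, i−j+1, i−j, ..., 1)`;
in 0-based terms `w(0) = i−1`, `w(1) = n`, `w(k) = i−k` for `2 ≤ k ≤ j−1`,
`w(k) = n+j−1−k` for `j ≤ k ≤ j+n−i−1`, `w(k) = n−k` for `j+n−i ≤ k ≤ n`.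
Then `w` is the unique element of `X⁺_{I,J}` covering `τ₀` in the restriction of
the Bruhat order to `X⁺_{I,J}`. -/
theorem stmt_12 (n : ℕ) (hn : 5 ≤ n) (i j : ℕ)
    (hi1 : 2 ≤ i) (hi2 : i ≤ n - 1) (hj1 : 2 < j) (hji : j ≤ i)
    (I J : Set (Fin n))
    (hI : I = ({⟨i - 1, by omega⟩} : Set (Fin n))ᶜ)
    (hJ : J = ({⟨0, by omega⟩, ⟨j - 1, by omega⟩} : Set (Fin n))ᶜ)
    (τ₀ : Equiv.Perm (Fin (n + 1)))
    (hτ : ∀ k : Fin (n + 1),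
      ((k : ℕ) < j → (τ₀ k : ℕ) = i - 1 - (k : ℕ)) ∧
      (j ≤ (k : ℕ) → (k : ℕ) ≤ j + n - i → (τ₀ k : ℕ) = n + j - (k : ℕ)) ∧
      (j + n + 1 - i ≤ (k : ℕ) → (τ₀ k : ℕ) = n - (k : ℕ)))
    (w : Equiv.Perm (Fin (n + 1)))
    (hw : (w ⟨0, by omega⟩ : ℕ) = i - 1 ∧ (w ⟨1, by omega⟩ : ℕ) = n ∧
      ∀ k : Fin (n + 1),
        (2 ≤ (k : ℕ) → (k : ℕ) ≤ j - 1 → (w k : ℕ) = i - (k : ℕ)) ∧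
        (j ≤ (k : ℕ) → (k : ℕ) ≤ j + n - i - 1 → (w k : ℕ) = n + j - 1 - (k : ℕ)) ∧
        (j + n - i ≤ (k : ℕ) → (w k : ℕ) = n - (k : ℕ))) :
    CoversIn (Xplus I J) τ₀ w ∧
      ∀ z : Equiv.Perm (Fin (n + 1)), CoversIn (Xplus I J) τ₀ z → z = w := by
  have hτX : τ₀ ∈ Xplus I J := by
    rw [hI, hJ]
    refine mem_Xplus_compl _ _ (fun r s h1 h2 => ?_) (fun r s h1 h2 h3 => ?_) <;>
    · have hr := hτ r
      have hs := hτ s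
      have hr' := r.2
      have hs' := s.2
      omega
  have hw' : ∀ k : Fin (n + 1), ((k : ℕ) = 0 → (w k : ℕ) = i - 1) ∧
      ((k : ℕ) = 1 → (w k : ℕ) = n) := fun k =>
    ⟨fun h => (congrArg (fun x => (w x : ℕ)) (Fin.ext h)).trans hw.1,
      fun h => (congrArg (fun x => (w x : ℕ)) (Fin.ext h)).trans hw.2.1⟩
  have hwX : w ∈ Xplus I J := by
    rw [hI, hJ]
    refine mem_Xplus_compl _ _ (fun r s h1 h2 => ?_) (fun r s h1 h2 h3 => ?_) <;>
    · have hr := hw.2.2 r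
      have hs := hw.2.2 s
      have hr₀ := hw' r
      have hs₀ := hw' s
      have hr' := r.2
      have hs' := s.2
      omega
  have hle : ∀ x ∈ Xplus I J, ∀ y ∈ Xplus I J,
      (∀ k ≤ j, bruhatRank x k i ≤ bruhatRank y k i) → bruhatLE x y := by
    intro x hx y hy h
    rw [hI, hJ] at hx hy
    refine bruhatLE_of_isTwoDecreasing (isTwoDecreasing_of_subset_Des (by omega) (by omega) hx.1)
      (isTwoDecreasing_of_subset_Des (by omega) (by omega) hy.1) (by omega)
      (bruhatRank_le_of_le (fun r s hr hrs => ?_) h)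
    refine lt_of_succ_lt (b := j) (c := n) (fun k hk h1 _ => ?_) hr hrs (by omega)
    exact @hy.2 ⟨k, by omega⟩ (by simp [Fin.ext_iff]; omega)
  have hτrank : ∀ k ≤ j, bruhatRank τ₀ k i = 0 := fun k hk =>
    bruhatRank_eq_zero _ fun r hr => by
      have := hτ r
      omega
  have hτw : bruhatLE τ₀ w := hle _ hτX _ hwX fun k hk => by simp [hτrank k hk]
  have hτw_ne : τ₀ ≠ w := by
    intro h
    have h1 := (hτ ⟨1, by omega⟩).1 (by simp only; omega)
    rw [h, hw.2.1] at h1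
    simp only at h1
    omega
  have hwrank : ∀ k ≤ j, bruhatRank w k i ≤ if k ≤ 1 then 0 else 1 := by
    intro k hk
    split_ifs with hk1
    · rw [bruhatRank_eq_zero]
      intro r hr
      have := hw' r
      omega
    · refine (Finset.card_le_card (t := {⟨1, by omega⟩}) ?_).trans_eq (Finset.card_singleton _)
      intro r hr
      simp only [Finset.mem_filter, Finset.mem_univ, true_and, Finset.mem_singleton,
        Fin.ext_iff] at hr ⊢
      have := hw' r
      have := hw.2.2 r
      omega
  have hwz : ∀ z ∈ Xplus I J, z ≠ τ₀ → bruhatLE w z := by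
    intro z hz hne
    have hbig : ∃ r : Fin (n + 1), (r : ℕ) < j ∧ i ≤ (z r : ℕ) := by
      by_contra hsmall
      push Not at hsmall
      have hzrank : ∀ k ≤ j, bruhatRank z k i = 0 := fun k hk =>
        bruhatRank_eq_zero _ fun r hr => hsmall r (by omega)
      exact hne ((hle _ hz _ hτX fun k hk => by simp [hzrank k hk]).antisymm
        (hle _ hτX _ hz fun k hk => by simp [hτrank k hk]))
    obtain ⟨r, hrj, hr⟩ := hbig
    have hbig' : ∃ r : Fin (n + 1), (r : ℕ) < 2 ∧ i ≤ (z r : ℕ) := by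
      by_cases hr2 : (r : ℕ) < 2
      · exact ⟨r, hr2, hr⟩
      · rw [hJ] at hz
        refine ⟨⟨1, by omega⟩, by simp, hr.trans (le_of_lt (Fin.lt_def.1 ?_))⟩
        refine lt_of_succ_lt (b := 1) (c := j - 1) (fun k hk h1 h2 => ?_) le_rfl
          (by rw [Fin.lt_def]; simp only; omega) (by omega)
        exact @hz.2 ⟨k, by omega⟩ (by simp [Fin.ext_iff]; omega)
    obtain ⟨s, hs2, hs⟩ := hbig'
    refine hle _ hwX _ hz fun k hk => (hwrank k hk).trans ?_
    split_ifs with hk1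
    · exact Nat.zero_le _
    · exact bruhatRank_pos z (by omega) hs
  refine ⟨⟨hτX, hwX, hτw, hτw_ne, fun z hz _ hzw => ?_⟩, fun z hz => ?_⟩
  · by_cases h : z = τ₀
    · exact Or.inl h
    · exact Or.inr (hzw.antisymm (hwz z hz h))
  · obtain ⟨-, hzX, -, hne, hcov⟩ := hz
    rcases hcov w hwX hτw (hwz z hzX hne.symm) with h | h
    · exact absurd h.symm hτw_ne
    · exact h.symm
end

section
/- Let n ≥ 5 and W = S_{n+1}. Let I = R − {s_i} with 2 ≤ i ≤ n−1 and J = R − {s_1, s_j} with 2 < j ≤ i. Define u ∈ W by u(1) = n+1, u(k) = i+2−k for 2 ≤ k ≤ j, u(k) = n+j+1−k for j+1 ≤ k ≤ j+n−i, and u(k) = n+2−k for j+n−i+1 ≤ k ≤ n+1 (so u = (n+1, i, i−1, ..., i−j+2, n, ..., i+1, i−j+1, ..., 1)). Then every w ∈ X⁺_{I,J} with u ≤ w in the Bruhat order satisfies w(1) = n+1, and the set {w ∈ X⁺_{I,J} : u ≤ w} is totally ordered by the Bruhat order (it is a chain). -/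
theorem swap_apply_cases {m : ℕ} {p q : Fin m} (c : Fin m) :
    (c = p ∧ Equiv.swap p q c = q) ∨ (c = q ∧ Equiv.swap p q c = p) ∨
      (c ≠ p ∧ c ≠ q ∧ Equiv.swap p q c = c) := by
  by_cases h1 : c = p
  · subst h1; simp
  · by_cases h2 : c = q
    · subst h2; simp
    · exact Or.inr (Or.inr ⟨h1, h2, Equiv.swap_apply_of_ne_of_ne h1 h2⟩)

/-- Exchanging the entries of an ascending pair of positions increases the length. -/
theorem sLen_lt_mul_swap {m : ℕ} (x : Equiv.Perm (Fin m)) {p q : Fin m} (hpq : p < q)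
    (hx : x p < x q) : sLen x < sLen (x * Equiv.swap p q) := by
  classical
  set s := Equiv.swap p q with hs
  have hss : ∀ c, s (s c) = c := fun c => by simp [hs]
  let φ : Fin m × Fin m → Fin m × Fin m :=
    fun e => if s e.1 < s e.2 then (s e.1, s e.2) else e
  unfold sLen
  set A := Finset.univ.filter fun e : Fin m × Fin m => e.1 < e.2 ∧ x e.2 < x e.1 with hA
  have hinj : Set.InjOn φ A := by
    rintro ⟨a, b⟩ hab ⟨c, d⟩ hcd h
    simp only [hA, Finset.coe_filter, Finset.mem_univ, true_and, Set.mem_ofPred_eq] at hab hcd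
    simp only [φ] at h
    split_ifs at h with h1 h2 h2
    · simpa using h
    · simp only [Prod.mk.injEq] at h
      rw [← h.1, ← h.2, hss, hss] at h2
      exact absurd hab.1 h2
    · simp only [Prod.mk.injEq] at h
      rw [h.1, h.2, hss, hss] at h1
      exact absurd hcd.1 h1
    · exact h
  rw [← Finset.card_image_of_injOn hinj]
  refine Finset.card_lt_card ((Finset.ssubset_iff_of_subset ?_).2 ⟨(p, q), ?_, ?_⟩)
  · rintro e he
    obtain ⟨⟨c, d⟩, hcd, rfl⟩ := Finset.mem_image.1 he
    simp only [hA, Finset.mem_filter, Finset.mem_univ, true_and] at hcd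
    simp only [φ]
    split_ifs with h1 <;>
      refine Finset.mem_filter.2 ⟨Finset.mem_univ _, ?_⟩ <;>
      simp only [Equiv.Perm.mul_apply]
    · simpa [hss] using ⟨h1, hcd.2⟩
    · refine ⟨hcd.1, ?_⟩
      obtain ⟨h2, h3⟩ := hcd
      rcases swap_apply_cases (p := p) (q := q) c with ⟨r1, r2⟩ | ⟨r1, r2⟩ | ⟨r1, r3, r2⟩ <;>
      rcases swap_apply_cases (p := p) (q := q) d with ⟨t1, t2⟩ | ⟨t1, t2⟩ | ⟨t1, t3, t2⟩ <;>
      rw [← hs] at r2 t2 <;> rw [r2, t2] at h1 ⊢ <;> grind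
  · simp [hs, hpq, hx]
  · intro h
    obtain ⟨⟨c, d⟩, hcd, h⟩ := Finset.mem_image.1 h
    simp only [hA, Finset.mem_filter, Finset.mem_univ, true_and] at hcd
    simp only [φ] at h
    split_ifs at h with h1
    · simp only [Prod.mk.injEq] at h
      have hc : c = q := by rw [← hss c, h.1]; simp [hs]
      have hd : d = p := by rw [← hss d, h.2]; simp [hs]
      subst hc hd
      exact absurd hcd.1 hpq.not_gt
    · simp only [Prod.mk.injEq] at h
      rw [h.1, h.2] at hcd
      exact absurd hcd.2 hx.not_gt

theorem lt_of_sLen_lt_mul_swap {m : ℕ} (x : Equiv.Perm (Fin m)) {p q : Fin m} (hpq : p < q)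
    (h : sLen x < sLen (x * Equiv.swap p q)) : x p < x q := by
  by_contra hx
  have hne : x p ≠ x q := fun e => hpq.ne (x.injective e)
  have := sLen_lt_mul_swap (x * Equiv.swap p q) hpq (by
    simpa using lt_of_le_of_ne (not_lt.1 hx) hne.symm)
  simp only [Equiv.mul_swap_mul_self] at this
  omega

/-- The first entry of a permutation grows weakly along the Bruhat order. -/
theorem bruhatLE.apply_zero_le {m : ℕ} {x y : Equiv.Perm (Fin (m + 1))} (h : bruhatLE x y) :
    x 0 ≤ y 0 := by
  induction h with
  | refl => exact le_rfl
  | @tail y z _ h ih =>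
    refine ih.trans ?_
    obtain ⟨⟨a, b, hab, rfl⟩, hlen⟩ := h
    wlog hlt : y.symm a < y.symm b generalizing a b
    · rw [Equiv.swap_comm] at hlen ⊢
      exact this b a hab.symm hlen (lt_of_le_of_ne (not_lt.1 hlt)
        (fun e => hab (y.symm.injective e.symm)))
    have hmul : Equiv.swap a b * y = y * Equiv.swap (y.symm a) (y.symm b) := by
      rw [Equiv.mul_swap_eq_swap_mul]; simp
    rw [hmul] at hlen ⊢
    have hxy := lt_of_sLen_lt_mul_swap y hlt hlen
    rw [Equiv.Perm.mul_apply]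
    rcases swap_apply_cases (p := y.symm a) (q := y.symm b) 0 with
      ⟨r1, r2⟩ | ⟨r1, r2⟩ | ⟨-, -, r2⟩ <;> rw [r2]
    · rw [r1]; exact hxy.le
    · rw [← r1] at hlt; exact absurd hlt (Fin.not_lt_zero _)

theorem bruhatLE_mul_swap {m : ℕ} (x : Equiv.Perm (Fin m)) {p q : Fin m} (hpq : p < q)
    (hx : x p < x q) : bruhatLE x (x * Equiv.swap p q) :=
  Relation.ReflTransGen.single
    ⟨⟨x p, x q, hx.ne, Equiv.mul_swap_eq_swap_mul _ _ _⟩, sLen_lt_mul_swap x hpq hx⟩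

theorem sLen_le {m : ℕ} (x : Equiv.Perm (Fin m)) : sLen x ≤ m * m := by
  refine (Finset.card_filter_le _ _).trans ?_
  simp

/-- Containment of inversion sets (the weak order) implies the Bruhat order. -/
theorem bruhatLE_of_inversions_subset {m : ℕ} (x y : Equiv.Perm (Fin (m + 1)))
    (h : ∀ p q, p < q → x q < x p → y.symm (x p) < y.symm (x q)) : bruhatLE x y := by
  induction hk : (m + 1) * (m + 1) - sLen x using Nat.strong_induction_on generalizing x with
  | _ k ih =>
  by_cases hasc : ∃ p : Fin m, x p.castSucc < x p.succ ∧
      y.symm (x p.succ) < y.symm (x p.castSucc)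
  · obtain ⟨p, hp, hpy⟩ := hasc
    have hps : p.castSucc < p.succ := Fin.castSucc_lt_succ
    have hlen := sLen_lt_mul_swap x hps hp
    have hle := sLen_le (x * Equiv.swap p.castSucc p.succ)
    refine (bruhatLE_mul_swap x hps hp).trans (ih _ (by omega) _ ?_ rfl)
    intro c d hcd hinv
    rw [Equiv.Perm.mul_apply, Equiv.Perm.mul_apply] at *
    rcases swap_apply_cases (p := p.castSucc) (q := p.succ) c with
      ⟨r1, r2⟩ | ⟨r1, r2⟩ | ⟨r1, r3, r2⟩ <;>
    rcases swap_apply_cases (p := p.castSucc) (q := p.succ) d with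
      ⟨t1, t2⟩ | ⟨t1, t2⟩ | ⟨t1, t3, t2⟩ <;>
    rw [r2, t2] at hinv ⊢ <;>
    first
    | assumption
    | (refine h _ _ ?_ hinv
       simp only [Fin.lt_def, Fin.ext_iff, Fin.val_succ, Fin.val_castSucc, ne_eq] at *
       omega)
  · have hmono : StrictMono fun p => y.symm (x p) := by
      refine Fin.strictMono_iff_lt_succ.2 fun p => ?_
      have hps : p.castSucc < p.succ := Fin.castSucc_lt_succ
      rcases lt_trichotomy (x p.castSucc) (x p.succ) with h1 | h1 | h1
      · refine lt_of_le_of_ne (not_lt.1 fun h2 => hasc ⟨p, h1, h2⟩) fun e => ?_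
        exact hps.ne (x.injective (y.symm.injective e))
      · exact absurd (x.injective h1) hps.ne
      · exact h _ _ hps h1
    have hxy : x = y := by
      ext1 p
      have hid : (x.trans y.symm) p = p := by
        have hr : Set.range (fun p => y.symm (x p)) = Set.range (id : Fin (m + 1) → _) := by
          rw [Set.range_id]; exact (x.trans y.symm).surjective.range_eq
        exact congrFun ((StrictMono.range_inj hmono strictMono_id).1 hr) p
      exact (Equiv.symm_apply_eq y).1 hid
    rw [hxy]; exact Relation.ReflTransGen.refl

theorem lt_of_consecutive_descents {n : ℕ} (f : Fin (n + 1) → Fin (n + 1)) (lo hi : ℕ)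
    (h : ∀ a : Fin n, lo ≤ a → (a : ℕ) + 1 ≤ hi → f a.succ < f a.castSucc)
    {x y : Fin (n + 1)} (hx : lo ≤ x) (hy : (y : ℕ) ≤ hi) (hxy : x < y) : f y < f x := by
  induction y using Fin.induction with
  | zero => exact absurd hxy (Fin.not_lt_zero _)
  | succ a ih =>
    have hxa : (x : ℕ) < a + 1 := hxy
    have hya : (a : ℕ) + 1 ≤ hi := hy
    have hstep := h a (by omega) hya
    rcases Nat.lt_succ_iff_lt_or_eq.1 hxa with h1 | h1
    · exact hstep.trans (ih (by simp; omega) h1)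
    · rwa [show x = a.castSucc from Fin.ext h1]

/-- Permutations with first entry `n`, decreasing on the positions `[1, j)` and `[j, n]`, and
with the values in `[0, i)` and those in `[i, n]` in decreasing order. -/
structure IsBlockDecreasing {n : ℕ} (i j : ℕ) (w : Equiv.Perm (Fin (n + 1))) : Prop where
  zero : (w 0 : ℕ) = n
  low : ∀ a b : Fin (n + 1), (b : ℕ) < i → a < b → w.symm b < w.symm a
  high : ∀ a b : Fin (n + 1), i ≤ (a : ℕ) → a < b → w.symm b < w.symm a
  left : ∀ p q : Fin (n + 1), 1 ≤ (p : ℕ) → (q : ℕ) < j → p < q → w q < w p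
  right : ∀ p q : Fin (n + 1), j ≤ (p : ℕ) → p < q → w q < w p

namespace IsBlockDecreasing

variable {n i j : ℕ} {w w' : Equiv.Perm (Fin (n + 1))}

theorem symm_eq_zero_iff (h : IsBlockDecreasing i j w) (a : Fin (n + 1)) :
    (w.symm a : ℕ) = 0 ↔ (a : ℕ) = n := by
  have h0 : w 0 = Fin.last n := Fin.ext h.zero
  rw [← Fin.val_zero (n + 1), ← Fin.ext_iff, Equiv.symm_apply_eq, h0, Fin.ext_iff, Fin.val_last]

/-- A non-inverted pair `a < b` occupies the two different blocks of positions. -/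
theorem blocks_of_lt (h : IsBlockDecreasing i j w) {a b : Fin (n + 1)} (hab : a < b)
    (hw : w.symm a < w.symm b) :
    ((a : ℕ) < i ∧ i ≤ (b : ℕ)) ∧ 0 < (w.symm a : ℕ) ∧ (w.symm a : ℕ) < j ∧
      j ≤ (w.symm b : ℕ) := by
  have hb := b.isLt
  have ha0 := h.symm_eq_zero_iff a
  have h1 := h.low a b
  have h2 := h.high a b
  have h3 := h.left (w.symm a) (w.symm b)
  have h4 := h.right (w.symm a) (w.symm b)
  simp only [Equiv.apply_symm_apply] at h3 h4
  simp only [Fin.lt_def] at *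
  omega

theorem block_eq_of_subset
    (hsub : ∀ a, 0 < (w.symm a : ℕ) ∧ (w.symm a : ℕ) < j →
      0 < (w'.symm a : ℕ) ∧ (w'.symm a : ℕ) < j) (a : Fin (n + 1))
    (ha : 0 < (w'.symm a : ℕ) ∧ (w'.symm a : ℕ) < j) :
    0 < (w.symm a : ℕ) ∧ (w.symm a : ℕ) < j := by
  classical
  let B := Finset.univ.filter fun p : Fin (n + 1) => 0 < (p : ℕ) ∧ (p : ℕ) < j
  have hmem : ∀ (v : Equiv.Perm (Fin (n + 1))) a, a ∈ B.map v.toEmbedding ↔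
      0 < (v.symm a : ℕ) ∧ (v.symm a : ℕ) < j := by
    intro v a
    rw [Finset.mem_map_equiv]
    simp [B]
  have heq : B.map w.toEmbedding = B.map w'.toEmbedding :=
    Finset.eq_of_subset_of_card_le (fun a h => (hmem w' a).2 (hsub a ((hmem w a).1 h)))
      (by simp)
  rw [← hmem, heq, hmem]
  exact ha

theorem false_of_crossing (h : IsBlockDecreasing i j w) (h' : IsBlockDecreasing i j w')
    {a b c d : Fin (n + 1)} (hab : a < b) (hcd : c < d)
    (h1 : w.symm b < w.symm a) (h1' : w'.symm a < w'.symm b)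
    (h2 : w.symm c < w.symm d) (h2' : w'.symm d < w'.symm c)
    (hd : (w'.symm d : ℕ) < j) : False := by
  obtain ⟨⟨hai, hbi⟩, ha0, haj, hbj⟩ := h'.blocks_of_lt hab h1'
  obtain ⟨⟨hci, hdi⟩, hc0, hcj, hdj⟩ := h.blocks_of_lt hcd h2
  have hd0' := h'.symm_eq_zero_iff d
  have hd0 := h.symm_eq_zero_iff d
  have hbd : b < d := by
    rcases lt_trichotomy b d with e | e | e
    · exact e
    · subst e; omega
    · have := h'.high d b hdi e
      simp only [Fin.lt_def] at this; omega
  have hbd' := h.high b d hbi hbd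
  have haj2 : j ≤ (w.symm a : ℕ) := by
    simp only [Fin.lt_def] at *; omega
  have hd' : 0 < (w'.symm d : ℕ) ∧ (w'.symm d : ℕ) < j := by omega
  have := block_eq_of_subset (w := w) (w' := w') (j := j) (fun x hx => ?_) d hd'
  · omega
  have hx0 := h.symm_eq_zero_iff x
  have hx0' := h'.symm_eq_zero_iff x
  refine ⟨by omega, ?_⟩
  by_cases hxi : (x : ℕ) < i
  · rcases lt_trichotomy a x with e | e | e
    · have := h'.low a x hxi e
      simp only [Fin.lt_def] at this; omega
    · subst e; omega
    · have := h.low x a hai e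
      simp only [Fin.lt_def] at this; omega
  · rcases lt_trichotomy d x with e | e | e
    · have := h'.high d x hdi e
      simp only [Fin.lt_def] at this; omega
    · subst e; omega
    · have := h.high x d (by omega) e
      simp only [Fin.lt_def] at this; omega

theorem bruhatLE_total (h : IsBlockDecreasing i j w) (h' : IsBlockDecreasing i j w') :
    bruhatLE w w' ∨ bruhatLE w' w := by
  by_contra hcon
  obtain ⟨hn1, hn2⟩ := not_or.1 hcon
  have key : ∀ v v' : Equiv.Perm (Fin (n + 1)), ¬ bruhatLE v v' →
      ∃ a b : Fin (n + 1), a < b ∧ v.symm b < v.symm a ∧ v'.symm a < v'.symm b := by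
    intro v v' hv
    by_contra! hno
    refine hv (bruhatLE_of_inversions_subset v v' fun p q hpq hvpq => ?_)
    refine lt_of_le_of_ne (hno (v q) (v p) hvpq (by simpa using hpq)) fun e => ?_
    exact hpq.ne (v.injective (v'.symm.injective e))
  obtain ⟨a, b, hab, h1, h1'⟩ := key w w' hn1
  obtain ⟨c, d, hcd, h2', h2⟩ := key w' w hn2
  by_cases hd : (w'.symm d : ℕ) < j
  · exact false_of_crossing h h' hab hcd h1 h1' h2 h2' hd
  · refine false_of_crossing h' h hcd hab h2' h2 h1' h1 ?_
    obtain ⟨⟨hai, -⟩, ha0, haj, -⟩ := h'.blocks_of_lt hab h1'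
    obtain ⟨⟨hci, -⟩, hc0, hcj, -⟩ := h.blocks_of_lt hcd h2
    have hca : c < a := by
      rcases lt_trichotomy c a with e | e | e
      · exact e
      · subst e; simp only [Fin.lt_def] at *; omega
      · have := h'.low a c hci e
        simp only [Fin.lt_def] at *; omega
    have := h.low c a hai hca
    simp only [Fin.lt_def] at *; omega

end IsBlockDecreasing

theorem isBlockDecreasing_of_mem_Xplus {n i j : ℕ} {I J : Set (Fin n)}
    (hi : 1 ≤ i) (hj : 1 ≤ j)
    (hI : ∀ a : Fin n, (a : ℕ) ≠ i - 1 → a ∈ I)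
    (hJ : ∀ a : Fin n, (a : ℕ) ≠ 0 → (a : ℕ) ≠ j - 1 → a ∈ J)
    {w : Equiv.Perm (Fin (n + 1))} (hw : w ∈ Xplus I J) (h0 : (w 0 : ℕ) = n) :
    IsBlockDecreasing i j w where
  zero := h0
  low a b hb hab := lt_of_consecutive_descents w.symm 0 (i - 1)
    (fun c _ hc => hw.1 (hI c (by omega))) (Nat.zero_le _) (by omega) hab
  high a b ha hab := lt_of_consecutive_descents w.symm i n
    (fun c hc _ => hw.1 (hI c (by omega))) ha (by omega) hab
  left p q hp hq hpq := lt_of_consecutive_descents w 1 (j - 1)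
    (fun c hc hc' => hw.2 (hJ c (by omega) (by omega))) hp (by omega) hpq
  right p q hp hpq := lt_of_consecutive_descents w j n
    (fun c hc _ => hw.2 (hJ c (by omega) (by omega))) hp (by omega) hpq

/-- Let `n ≥ 5`, `I = R − {s_i}` with `2 ≤ i ≤ n−1`, `J = R − {s_1, s_j}` with
`2 < j ≤ i` (all 1-based).  Let `u = (n+1, i, i−1, ..., i−j+2, n, ..., i+1, i−j+1, ..., 1)`;
in 0-based terms `u(0) = n`, `u(k) = i−k` for `1 ≤ k ≤ j−1`, `u(k) = n+j−1−k` for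
`j ≤ k ≤ j+n−i−1`, `u(k) = n−k` for `j+n−i ≤ k ≤ n`.  Then every `w ∈ X⁺_{I,J}`
with `u ≤ w` in the Bruhat order has first entry `n+1` (0-based value `n`), and
`{w ∈ X⁺_{I,J} : u ≤ w}` is a chain in the Bruhat order. -/
theorem stmt_14 (n : ℕ) (hn : 5 ≤ n) (i j : ℕ)
    (hi1 : 2 ≤ i) (hi2 : i ≤ n - 1) (hj1 : 2 < j) (hji : j ≤ i)
    (I J : Set (Fin n))
    (hI : I = ({⟨i - 1, by omega⟩} : Set (Fin n))ᶜ)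
    (hJ : J = ({⟨0, by omega⟩, ⟨j - 1, by omega⟩} : Set (Fin n))ᶜ)
    (u : Equiv.Perm (Fin (n + 1)))
    (hu : (u ⟨0, by omega⟩ : ℕ) = n ∧
      ∀ k : Fin (n + 1),
        (1 ≤ (k : ℕ) → (k : ℕ) ≤ j - 1 → (u k : ℕ) = i - (k : ℕ)) ∧
        (j ≤ (k : ℕ) → (k : ℕ) ≤ j + n - i - 1 → (u k : ℕ) = n + j - 1 - (k : ℕ)) ∧
        (j + n - i ≤ (k : ℕ) → (u k : ℕ) = n - (k : ℕ))) :
    (∀ w ∈ Xplus I J, bruhatLE u w → (w ⟨0, by omega⟩ : ℕ) = n) ∧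
      IsChainOn {w ∈ Xplus I J | bruhatLE u w} := by
  have hfirst : ∀ w : Equiv.Perm (Fin (n + 1)), bruhatLE u w → (w 0 : ℕ) = n := by
    intro w hw
    have h1 : (u 0 : ℕ) ≤ w 0 := hw.apply_zero_le
    have h2 : (u 0 : ℕ) = n := hu.1
    omega
  have hblock : ∀ w ∈ {w ∈ Xplus I J | bruhatLE u w}, IsBlockDecreasing i j w := by
    rintro w ⟨hw, huw⟩
    refine isBlockDecreasing_of_mem_Xplus (by omega) (by omega) (fun a ha => ?_)
      (fun a ha ha' => ?_) hw (hfirst w huw)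
    · simpa [hI, Fin.ext_iff] using ha
    · simpa [hJ, Fin.ext_iff] using ⟨ha, ha'⟩
  exact ⟨fun w _ hw => hfirst w hw,
    fun x hx y hy => (hblock x hx).bruhatLE_total (hblock y hy)⟩
end

section
/- Let n ≥ 5 and W = S_{n+1}, with longest element w₀ (w₀(k) = n+2−k). Let I = R − {s_i} with 2 ≤ i ≤ n−1 and J = R − {s_1, s_j} with 2 < j < n−1. If n > i + j − 2, then w₀ covers exactly one element of X⁺_{I,J} in the restriction of the Bruhat order to X⁺_{I,J}, namely the permutation u with u(k) = n+2−k for 1 ≤ k ≤ j−1, u(j) = i, and whose remaining entries (positions j+1 through n+1) are the elements of {1, ..., n+2−j} \ {i} arranged in decreasing order. If n ≤ i + j − 2, then w₀ covers exactly two elements of X⁺_{I,J}. -/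
namespace Bruhat

open Equiv

/-- The rank function of a permutation: the number of positions below `p` with value below `q`. -/
def rk {m : ℕ} (x : Perm (Fin m)) (p q : ℕ) : ℕ :=
  (Finset.univ.filter fun k : Fin m => (k : ℕ) < p ∧ (x k : ℕ) < q).card

section Rank

variable {m : ℕ} (x y : Perm (Fin m))

lemma rk_inv (p q : ℕ) : rk x⁻¹ p q = rk x q p := by
  unfold rk
  refine Finset.card_equiv x⁻¹ fun k => ?_
  simp [and_comm]

lemma rk_zero_left (q : ℕ) : rk x 0 q = 0 := by simp [rk]

lemma rk_succ (p : Fin m) (q : ℕ) :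
    rk x (p + 1) q = rk x p q + if (x p : ℕ) < q then 1 else 0 := by
  unfold rk
  split_ifs with h
  · rw [← Finset.card_insert_of_notMem (a := p) (by simp)]
    congr 1
    ext k
    simp only [Finset.mem_filter, Finset.mem_univ, true_and, Finset.mem_insert]
    grind
  · rw [add_zero]
    congr 1
    ext k
    simp only [Finset.mem_filter, Finset.mem_univ, true_and]
    grind

lemma rk_succ_of_le {p : ℕ} (hp : m ≤ p) (q : ℕ) : rk x (p + 1) q = rk x p q := by
  unfold rk
  congr 1
  ext k
  have := k.isLt
  simp only [Finset.mem_filter, Finset.mem_univ, true_and]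
  omega

lemma rk_le_rk_succ (p q : ℕ) : rk x p q ≤ rk x (p + 1) q := by
  by_cases hp : p < m
  · have := rk_succ x ⟨p, hp⟩ q
    simp only at this
    omega
  · rw [rk_succ_of_le x (by omega)]

lemma rk_succ_le (p q : ℕ) : rk x (p + 1) q ≤ rk x p q + 1 := by
  by_cases hp : p < m
  · have := rk_succ x ⟨p, hp⟩ q
    simp only at this
    split_ifs at this <;> omega
  · rw [rk_succ_of_le x (by omega)]; omega

lemma rk_mono_left {p p' : ℕ} (h : p ≤ p') (q : ℕ) : rk x p q ≤ rk x p' q :=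
  monotone_nat_of_le_succ (f := fun p => rk x p q) (fun p => rk_le_rk_succ x p q) h

lemma rk_size_left (q : ℕ) : rk x m q = rk y m q := by
  rw [← rk_inv x, ← rk_inv y]
  simp [rk]

lemma rk_congr {x y : Perm (Fin m)} {p : ℕ} (h : ∀ k : Fin m, (k : ℕ) < p → x k = y k) (q : ℕ) :
    rk x p q = rk y p q := by
  unfold rk
  congr 1
  ext k
  simp only [Finset.mem_filter, Finset.mem_univ, true_and]
  grind

lemma rk_mul_swap {k l : Fin m} (hkl : k < l) (hx : x k < x l) (r q : ℕ) :
    rk (x * swap k l) r q +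
      (if (k : ℕ) < r ∧ r ≤ l ∧ (x k : ℕ) < q ∧ q ≤ x l then 1 else 0) = rk x r q := by
  rw [Fin.lt_def] at hkl hx
  induction r with
  | zero => simp [rk_zero_left]
  | succ r ih =>
    by_cases hr : r < m
    · have h1 := rk_succ x ⟨r, hr⟩ q
      have h2 := rk_succ (x * swap k l) ⟨r, hr⟩ q
      have hmul : ∀ c, (x * swap k l) c = x (swap k l c) := fun c => rfl
      by_cases hk : (⟨r, hr⟩ : Fin m) = k
      · subst hk
        have e := hmul ⟨r, hr⟩
        rw [swap_apply_left] at e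
        simp only [e] at *
        split_ifs at * <;> omega
      by_cases hl : (⟨r, hr⟩ : Fin m) = l
      · subst hl
        have e := hmul ⟨r, hr⟩
        rw [swap_apply_right] at e
        simp only [e] at *
        split_ifs at * <;> omega
      have e := hmul ⟨r, hr⟩
      rw [swap_apply_of_ne_of_ne hk hl] at e
      rw [Fin.ext_iff] at hk hl
      simp only [e] at *
      split_ifs at * <;> omega
    · rw [rk_succ_of_le _ (by omega), rk_succ_of_le _ (by omega), ← ih]
      have := l.isLt
      split_ifs <;> omega

end Rank

section Length

variable {m : ℕ} {x y : Perm (Fin m)}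

lemma sLen_lt_mul_swap {k l : Fin m} (hkl : k < l) (hx : x k < x l) :
    sLen x < sLen (x * swap k l) := by
  unfold sLen
  set σ := swap k l with hσ
  have hσσ : ∀ c, σ (σ c) = c := fun c => swap_apply_self k l c
  have hcases : ∀ c, (c = k ∧ σ c = l) ∨ (c = l ∧ σ c = k) ∨ (c ≠ k ∧ c ≠ l ∧ σ c = c) := by
    intro c
    rw [hσ, swap_apply_def]
    grind
  let φ : Fin m × Fin m → Fin m × Fin m :=
    fun p => if σ p.1 < σ p.2 then (σ p.1, σ p.2) else p
  rw [← Finset.card_image_of_injOn (f := φ)]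
  · refine Finset.card_lt_card (Finset.ssubset_iff_of_subset ?_ |>.2 ⟨(k, l), ?_, ?_⟩)
    · intro p hp
      simp only [Finset.mem_image, Finset.mem_filter, Finset.mem_univ, true_and] at hp ⊢
      obtain ⟨⟨c, d⟩, ⟨hcd, hxcd⟩, rfl⟩ := hp
      simp only [φ, Perm.mul_apply] at *
      split_ifs with h
      · simpa [h, hσσ] using hxcd
      · refine ⟨hcd, ?_⟩
        dsimp only
        rcases hcases c with ⟨h1, h2⟩ | ⟨h1, h2⟩ | ⟨h1, h1', h2⟩ <;>
        rcases hcases d with ⟨h3, h4⟩ | ⟨h3, h4⟩ | ⟨h3, h3', h4⟩ <;>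
        rw [h2, h4] at * <;> grind
    · have h1 : σ k = l := swap_apply_left k l
      have h2 : σ l = k := swap_apply_right k l
      rw [Finset.mem_filter]
      simp [h1, h2, hkl, hx]
    · simp only [Finset.mem_image, Finset.mem_filter, Finset.mem_univ, true_and, not_exists,
        not_and, and_imp, Prod.forall, φ]
      intro c d hcd hxcd h
      have := hσσ c
      have := hσσ d
      have h1 : σ k = l := swap_apply_left k l
      have h2 : σ l = k := swap_apply_right k l
      split_ifs at h <;> simp only [Prod.mk.injEq] at h <;> grind
  · rintro ⟨c, d⟩ h ⟨c', d'⟩ h' he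
    simp only [Finset.coe_filter, Finset.mem_univ, true_and, Set.mem_ofPred_eq, φ] at h h' he
    have := hσσ c
    have := hσσ d
    have := hσσ c'
    have := hσσ d'
    split_ifs at he <;> simp only [Prod.mk.injEq] at he ⊢ <;> grind

lemma sLen_le (x : Perm (Fin m)) : sLen x ≤ m * m := by
  unfold sLen
  refine (Finset.card_le_univ _).trans ?_
  simp

lemma sLen_le_of_bruhatLE (h : bruhatLE x y) : sLen x ≤ sLen y := by
  induction h with
  | refl => exact le_rfl
  | tail _ h ih => exact ih.trans h.2.le

lemma bruhatLE_antisymm (hxy : bruhatLE x y) (hyx : bruhatLE y x) : x = y := by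
  rcases Relation.ReflTransGen.cases_tail hxy with h | ⟨z, hz, h⟩
  · exact h.symm
  · have h1 := sLen_le_of_bruhatLE hz
    have h2 := sLen_le_of_bruhatLE hyx
    have := h.2
    omega

lemma rk_le_of_swap_step {k l : Fin m} (hkl : k < l) (h : sLen x < sLen (x * swap k l))
    (p q : ℕ) : rk (x * swap k l) p q ≤ rk x p q := by
  rcases lt_or_ge (x k) (x l) with hx | hx
  · have := rk_mul_swap x hkl hx p q
    omega
  · have hne : x l ≠ x k := fun e => hkl.ne' (x.injective e)
    have := sLen_lt_mul_swap (x := x * swap k l) hkl (by simpa using lt_of_le_of_ne hx hne)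
    rw [mul_assoc, swap_mul_self, mul_one] at this
    omega

/-- Rank functions are antitone in the Bruhat order. -/
lemma rk_le_of_bruhatLE (h : bruhatLE x y) (p q : ℕ) : rk y p q ≤ rk x p q := by
  induction h with
  | refl => exact le_rfl
  | @tail z w _ h ih =>
    refine le_trans ?_ ih
    obtain ⟨⟨a, b, hab, rfl⟩, hlen⟩ := h
    have e : swap a b * z = z * swap (z⁻¹ a) (z⁻¹ b) := by
      rw [mul_swap_eq_swap_mul]; simp
    rw [e] at hlen ⊢
    have hne : z⁻¹ a ≠ z⁻¹ b := fun e => hab (z⁻¹.injective e)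
    rcases lt_or_gt_of_ne hne with h | h
    · exact rk_le_of_swap_step h hlen p q
    · rw [swap_comm] at hlen ⊢
      exact rk_le_of_swap_step h hlen p q

lemma exists_swap_of_rk_le (hxy : x ≠ y) (hrk : ∀ p q, rk y p q ≤ rk x p q) :
    ∃ k l : Fin m, k < l ∧ x k < x l ∧ ∀ p q, rk y p q ≤ rk (x * swap k l) p q := by
  have hex : ∃ p, x p ≠ y p := by
    by_contra! h
    exact hxy (Equiv.ext h)
  obtain ⟨p, hp, hmin⟩ := WellFounded.has_min (wellFounded_lt (α := Fin m)) {p | x p ≠ y p} hex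
  have hagree : ∀ k : Fin m, (k : ℕ) < p → x k = y k := fun k hk => by
    by_contra h
    exact hmin k h hk
  have hpref := rk_congr hagree
  have hpv : (x p : ℕ) ≠ y p := fun e => hp (Fin.ext e)
  have hlt : (x p : ℕ) < y p := by
    have h1 := rk_succ x p (y p + 1)
    have h2 := rk_succ y p (y p + 1)
    have h3 := hrk (p + 1) (y p + 1)
    have h4 := hpref (y p + 1)
    split_ifs at h1 h2 <;> omega
  have hex' : ∃ k, p < k ∧ x p < x k ∧ x k ≤ y p := by
    refine ⟨x⁻¹ (y p), ?_, by simpa using hlt, by simp⟩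
    by_contra! h
    rcases lt_or_eq_of_le h with h | h
    · have := hagree _ h
      simp only [Perm.coe_inv, apply_symm_apply] at this
      exact h.ne (y.injective this).symm
    · apply hp
      conv_lhs => rw [← h]
      simp
  obtain ⟨k, ⟨hpk, hxk, hky⟩, hkmin⟩ :=
    WellFounded.has_min (wellFounded_lt (α := Fin m)) {k | p < k ∧ x p < x k ∧ x k ≤ y p} hex'
  refine ⟨p, k, hpk, hxk, fun r q => ?_⟩
  have hsw := rk_mul_swap x hpk hxk r q
  have hr := hrk r q
  split_ifs at hsw with hc
  swap; · omega
  obtain ⟨hpr, hrk', hxq, hqx⟩ := hc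
  have hX : ∀ r : ℕ, (p : ℕ) + 1 ≤ r → r ≤ k →
      rk x r (y p + 1) + rk x p q = rk x p (y p + 1) + rk x r q := by
    intro r h
    induction r, h using Nat.le_induction with
    | base =>
      intro _
      rw [rk_succ, rk_succ, if_pos (by omega), if_pos hxq]
      omega
    | succ r hr ih =>
      intro hrk'
      have ih := ih (by omega)
      have hrm : r < m := by omega
      have h1 := rk_succ x ⟨r, hrm⟩ (y p + 1)
      have h2 := rk_succ x ⟨r, hrm⟩ q
      have h3 : ¬ ((x p : ℕ) < x ⟨r, hrm⟩ ∧ (x ⟨r, hrm⟩ : ℕ) ≤ y p) := fun h =>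
        hkmin ⟨r, hrm⟩ ⟨Fin.lt_def.2 (by simp only; omega), h.1, h.2⟩
          (Fin.lt_def.2 (by simp only; omega))
      rw [Fin.le_def] at hky
      simp only at h1 h2
      split_ifs at h1 h2 <;> omega
  have hY : ∀ r : ℕ, (p : ℕ) + 1 ≤ r →
      rk y p (y p + 1) + rk y r q + 1 ≤ rk y r (y p + 1) + rk y p q := by
    rw [Fin.le_def] at hky
    intro r h
    induction r, h using Nat.le_induction with
    | base =>
      rw [rk_succ, rk_succ, if_neg (by omega), if_pos (by omega)]
      omega
    | succ r hr ih =>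
      by_cases hrm : r < m
      · have h1 := rk_succ y ⟨r, hrm⟩ (y p + 1)
        have h2 := rk_succ y ⟨r, hrm⟩ q
        simp only at h1 h2
        split_ifs at h1 h2 <;> omega
      · rw [rk_succ_of_le _ (by omega), rk_succ_of_le _ (by omega)]
        exact ih
  have h1 := hX r hpr hrk'
  have h2 := hY r hpr
  have h3 := hpref q
  have h4 := hpref (y p + 1)
  have h5 := hrk r (y p + 1)
  omega

/-- The rank criterion for the Bruhat order. -/
theorem bruhatLE_of_rk_le (hrk : ∀ p q, rk y p q ≤ rk x p q) : bruhatLE x y := by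
  induction hd : m * m - sLen x using Nat.strong_induction_on generalizing x with
  | _ d ih =>
    by_cases hxy : x = y
    · exact hxy ▸ Relation.ReflTransGen.refl
    · obtain ⟨k, l, hkl, hx, h⟩ := exists_swap_of_rk_le hxy hrk
      have hlen := sLen_lt_mul_swap hkl hx
      have hle := sLen_le (x * swap k l)
      refine Relation.ReflTransGen.head ⟨⟨x k, x l, hx.ne, mul_swap_eq_swap_mul x k l⟩, hlen⟩ ?_
      exact ih _ (by omega) h rfl

end Length

section Blocks

/-- A sequence with steps `0` or `1`, all `0`s preceding all `1`s between `b` and `c`, is dominated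
there by any sequence with steps `0` or `1` dominating it at `b` and at `c`. -/
lemma le_of_steps {f g : ℕ → ℕ} {b c : ℕ} (hf : ∀ k, f k ≤ f (k + 1))
    (hf' : ∀ k, f (k + 1) ≤ f k + 1) (hg : ∀ k, g (k + 1) ≤ g k + 1)
    (hconv : ∀ k, b ≤ k → k + 1 < c → g k < g (k + 1) → g (k + 1) < g (k + 1 + 1))
    (hb : g b ≤ f b) (hc : g c ≤ f c) {p : ℕ} (hbp : b ≤ p) (hpc : p ≤ c) : g p ≤ f p := by
  induction p, hbp using Nat.le_induction with
  | base => exact hb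
  | succ p hp ih =>
    by_contra! hlt
    have ih := ih (by omega)
    have h1 := hf p
    have h2 := hg p
    have key : ∀ r, p + 1 ≤ r → r ≤ c → f r < g r ∧ g (r - 1) < g r := by
      intro r hr
      induction r, hr using Nat.le_induction with
      | base =>
        intro _
        exact ⟨hlt, by simp only [Nat.add_sub_cancel]; omega⟩
      | succ r hr ihr =>
        intro hrc
        obtain ⟨h3, h4⟩ := ihr (by omega)
        obtain ⟨t, rfl⟩ : ∃ t, r = t + 1 := ⟨r - 1, by omega⟩
        simp only [Nat.add_sub_cancel] at h4 ⊢
        have h5 : g (t + 1) < g (t + 1 + 1) := hconv t (by omega) (by omega) h4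
        have h6 := hf' (t + 1)
        exact ⟨by omega, h5⟩
    have := (key c hpc le_rfl).1
    omega

variable {m : ℕ} {x y : Perm (Fin m)}

lemma rk_le_of_antitone_block {b c : ℕ} {q : ℕ}
    (hdec : ∀ (k : ℕ) (h : k + 1 < m), b ≤ k → k + 1 < c → y ⟨k + 1, h⟩ < y ⟨k, by omega⟩)
    (hcm : c ≤ m) (hb : rk y b q ≤ rk x b q) (hc : rk y c q ≤ rk x c q) {p : ℕ} (hbp : b ≤ p)
    (hpc : p ≤ c) : rk y p q ≤ rk x p q := by
  refine le_of_steps (f := fun p => rk x p q) (g := fun p => rk y p q)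
    (fun k => rk_le_rk_succ x k q) (fun k => rk_succ_le x k q) (fun k => rk_succ_le y k q)
    ?_ hb hc hbp hpc
  intro k hbk hkc h
  have hd := hdec k (by omega) hbk hkc
  rw [Fin.lt_def] at hd
  have h1 := rk_succ y ⟨k, by omega⟩ q
  have h2 := rk_succ y ⟨k + 1, by omega⟩ q
  simp only at h h1 h2 ⊢
  split_ifs at h1 h2 <;> omega

lemma rk_le_of_ge_size {q : ℕ} {p : ℕ} (hp : m ≤ p) : rk y p q ≤ rk x p q := by
  have h : ∀ z : Perm (Fin m), rk z p q = rk z m q := fun z => by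
    induction p, hp using Nat.le_induction with
    | base => rfl
    | succ p hp ih => rw [rk_succ_of_le z hp, ih]
  rw [h, h, rk_size_left y x]

/-- If `y` is decreasing on each of the position blocks delimited by
`0, 1, j, m`, then the rank function of `y` is dominated as soon as it is so at `1` and `j`. -/
lemma rk_le_of_three_blocks {j q : ℕ} (hj : 1 ≤ j) (hjm : j ≤ m)
    (hdec : ∀ (k : ℕ) (h : k + 1 < m), k ≠ 0 → k + 1 ≠ j → y ⟨k + 1, h⟩ < y ⟨k, by omega⟩)
    (h1 : rk y 1 q ≤ rk x 1 q) (h2 : rk y j q ≤ rk x j q) (p : ℕ) : rk y p q ≤ rk x p q := by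
  rcases Nat.lt_or_ge p 1 with hp | hp
  · obtain rfl : p = 0 := by omega
    simp [rk_zero_left]
  rcases Nat.lt_or_ge j p with hp' | hp'
  · rcases Nat.lt_or_ge m p with hpm | hpm
    · exact rk_le_of_ge_size hpm.le
    · exact rk_le_of_antitone_block (b := j) (c := m)
        (fun k h hk _ => hdec k h (by omega) (by omega)) le_rfl h2 (rk_le_of_ge_size le_rfl)
        hp'.le hpm
  · exact rk_le_of_antitone_block (b := 1) (c := j)
      (fun k h hk _ => hdec k h (by omega) (by omega)) hjm h1 h2 hp hp'

lemma rk_le_of_two_blocks {i q : ℕ} (him : i ≤ m)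
    (hdec : ∀ (k : ℕ) (h : k + 1 < m), k + 1 ≠ i → y ⟨k + 1, h⟩ < y ⟨k, by omega⟩)
    (h2 : rk y i q ≤ rk x i q) (p : ℕ) : rk y p q ≤ rk x p q := by
  rcases Nat.lt_or_ge i p with hp' | hp'
  · rcases Nat.lt_or_ge m p with hpm | hpm
    · exact rk_le_of_ge_size hpm.le
    · exact rk_le_of_antitone_block (b := i) (c := m)
        (fun k h hk _ => hdec k h (by omega)) le_rfl h2 (rk_le_of_ge_size le_rfl)
        hp'.le hpm
  · exact rk_le_of_antitone_block (b := 0) (c := i)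
      (fun k h hk _ => hdec k h (by omega)) him (by simp [rk_zero_left]) h2 (by omega) hp'

end Blocks

section Cosets

variable {n : ℕ}

/-- Membership in `X⁺_{I,J}` for `I = R − {s_i}` and `J = R − {s_1, s_j}`. -/
def IsMaxRep (i j : ℕ) (y : Perm (Fin (n + 1))) : Prop :=
  (∀ (k : ℕ) (h : k + 1 < n + 1), k + 1 ≠ i → y⁻¹ ⟨k + 1, h⟩ < y⁻¹ ⟨k, by omega⟩) ∧
  ∀ (k : ℕ) (h : k + 1 < n + 1), k ≠ 0 → k + 1 ≠ j → y ⟨k + 1, h⟩ < y ⟨k, by omega⟩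

lemma mem_Xplus_iff {i j : ℕ} (hi : 1 ≤ i) (hin : i - 1 < n) (hj : 1 ≤ j) (hjn : j - 1 < n)
    (hn : 0 < n) (y : Perm (Fin (n + 1))) :
    y ∈ Xplus (({⟨i - 1, hin⟩} : Set (Fin n))ᶜ) (({⟨0, hn⟩, ⟨j - 1, hjn⟩} : Set (Fin n))ᶜ) ↔
      IsMaxRep i j y := by
  simp only [Xplus, Set.mem_ofPred_eq, IsMaxRep, Des, Set.subset_def, Set.mem_compl_iff,
    Set.mem_singleton_iff, Set.mem_insert_iff, not_or, Fin.forall_iff, Fin.ext_iff]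
  refine and_congr ⟨fun h k hk hki => h k (by omega) (by omega),
    fun h k hk hki => h k (by omega) (by omega)⟩
    ⟨fun h k hk h0 hkj => h k (by omega) ⟨h0, by omega⟩,
    fun h k hk hkj => h k (by omega) hkj.1 (by have := hkj.2; omega)⟩

variable {i j : ℕ} {x y : Perm (Fin (n + 1))}

lemma IsMaxRep.bruhatLE_of_rk_le (hy : IsMaxRep i j y) (hi : i ≤ n + 1) (hj : 1 ≤ j)
    (hjn : j ≤ n + 1) (h1 : rk y 1 i ≤ rk x 1 i) (h2 : rk y j i ≤ rk x j i) : bruhatLE x y := by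
  refine Bruhat.bruhatLE_of_rk_le fun p q => ?_
  have hp := rk_le_of_three_blocks hj hjn hy.2 h1 h2 p
  rw [← rk_inv x, ← rk_inv y] at hp ⊢
  exact rk_le_of_two_blocks hi hy.1 hp q

lemma IsMaxRep.eq_of_rk_eq (hx : IsMaxRep i j x) (hy : IsMaxRep i j y) (hi : i ≤ n + 1)
    (hj : 1 ≤ j) (hjn : j ≤ n + 1) (h1 : rk y 1 i = rk x 1 i) (h2 : rk y j i = rk x j i) :
    x = y :=
  bruhatLE_antisymm (hy.bruhatLE_of_rk_le hi hj hjn h1.le h2.le)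
    (hx.bruhatLE_of_rk_le hi hj hjn h1.ge h2.ge)

lemma isMaxRep_revPerm : IsMaxRep i j (Fin.revPerm : Perm (Fin (n + 1))) := by
  have h : (Fin.revPerm : Perm (Fin (n + 1)))⁻¹ = Fin.revPerm := Fin.revPerm_symm
  refine ⟨fun k hk _ => ?_, fun k hk _ _ => ?_⟩ <;> simp [h, Fin.lt_def] <;> omega

lemma rk_eq_of_forall {p q lo hi : ℕ} (hlo : hi ≤ n + 1)
    (h : ∀ k : Fin (n + 1), ((k : ℕ) < p ∧ (x k : ℕ) < q) ↔ (lo ≤ (k : ℕ) ∧ (k : ℕ) < hi)) :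
    rk x p q = hi - lo := by
  unfold rk
  rw [← Nat.card_Ico, ← Finset.card_map Fin.valEmbedding]
  congr 1
  ext t
  simp only [Finset.mem_map, Finset.mem_filter, Finset.mem_univ, true_and, h,
    Fin.valEmbedding_apply, Finset.mem_Ico]
  exact ⟨by rintro ⟨k, hk, rfl⟩; exact hk, fun ht => ⟨⟨t, by omega⟩, ht, rfl⟩⟩

lemma rk_revPerm (p q : ℕ) (hp : p ≤ n + 1) :
    rk (Fin.revPerm : Perm (Fin (n + 1))) p q = p - (n + 1 - q) := by
  refine rk_eq_of_forall hp fun k => ?_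
  have := k.isLt
  simp only [Fin.revPerm_apply, Fin.val_rev]
  omega

lemma rk_revPerm_le (x : Perm (Fin (n + 1))) (p q : ℕ) : rk (Fin.revPerm : Perm (Fin (n + 1))) p q ≤ rk x p q := by
  rcases Nat.lt_or_ge (n + 1) p with hp | hp
  · exact rk_le_of_ge_size hp.le
  · exact rk_le_of_antitone_block (b := 0) (c := n + 1)
      (fun k h _ _ => by simp [Fin.lt_def]; omega) le_rfl (by simp [rk_zero_left])
      (rk_le_of_ge_size le_rfl) (by omega) hp

lemma exists_perm {F : ℕ → ℕ} (hF : ∀ k ≤ n, F k ≤ n)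
    (hinj : ∀ k ≤ n, ∀ l ≤ n, F k = F l → k = l) :
    ∃ u : Perm (Fin (n + 1)), ∀ k, (u k : ℕ) = F k := by
  let f : Fin (n + 1) → Fin (n + 1) := fun k => ⟨F k, by have := hF k (by omega); omega⟩
  have hf : Function.Injective f := fun k l h =>
    Fin.ext (hinj k (by omega) l (by omega) (by simpa [f] using h))
  exact ⟨Equiv.ofBijective f (Finite.injective_iff_bijective.1 hf), fun k => rfl⟩

lemma isMaxRep_of_forall {F : ℕ → ℕ} (hu : ∀ k, (x k : ℕ) = F k)
    (h1 : ∀ k ≤ n, ∀ l ≤ n, F l = F k + 1 → F l ≠ i → l < k)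
    (h2 : ∀ k < n, k ≠ 0 → k + 1 ≠ j → F (k + 1) < F k) : IsMaxRep i j x := by
  refine ⟨fun k hk hki => ?_, fun k hk h0 hkj => ?_⟩
  · have e : ∀ t : Fin (n + 1), (t : ℕ) = F (x⁻¹ t) := fun t => by
      rw [← hu]
      exact congrArg Fin.val (x.apply_symm_apply t).symm
    have e1 : k + 1 = _ := e ⟨k + 1, hk⟩
    have e2 : k = _ := e ⟨k, by omega⟩
    exact h1 _ (by omega) _ (by omega) (by omega) (by omega)
  · rw [Fin.lt_def, hu, hu]
    exact h2 k (by omega) h0 hkj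

/-- The maximal representative with high first entry and `s` low values (those below `i`) among
its first `j` entries. -/
lemma exists_rep_high (s : ℕ) (hi : i ≤ n) (hj : j ≤ n) (hs : 1 ≤ s) (hsi : s ≤ i)
    (hsj : s + 1 ≤ j) (hs' : i + j ≤ n + 1 + s) :
    ∃ u : Perm (Fin (n + 1)), IsMaxRep i j u ∧ rk u 1 i = 0 ∧ rk u j i = s ∧
      (∀ k : Fin (n + 1), (k : ℕ) + s + 1 ≤ j → (u k : ℕ) = n - k) ∧
      (∀ k : Fin (n + 1), (k : ℕ) + s = j → (u k : ℕ) = i - 1) ∧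
      ∀ k l : Fin (n + 1), j ≤ (k : ℕ) → k < l → u l < u k := by
  obtain ⟨F, hF⟩ : ∃ F : ℕ → ℕ, ∀ p, F p = if p + s < j then n - p else if p < j then
    i + j - 1 - p - s else if p + i ≤ n + s then n - p + s else n - p := ⟨_, fun _ => rfl⟩
  obtain ⟨u, hu⟩ := exists_perm (n := n) (F := F)
    (fun k hk => by rw [hF]; split_ifs <;> omega)
    (fun k hk l hl h => by rw [hF, hF] at h; split_ifs at h <;> omega)
  refine ⟨u, isMaxRep_of_forall hu ?_ ?_, ?_, ?_, ?_, ?_, ?_⟩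
  · intro k hk l hl h h'
    rw [hF] at h' h
    rw [hF] at h
    split_ifs at h h' <;> omega
  · intro k hk h0 hkj
    rw [hF, hF]
    split_ifs <;> omega
  · rw [rk_eq_of_forall (lo := 0) (hi := 0) (by omega)]
    intro k
    rw [hu, hF]
    split_ifs <;> omega
  · rw [rk_eq_of_forall (lo := j - s) (hi := j) (by omega)]
    · omega
    intro k
    rw [hu, hF]
    split_ifs <;> omega
  · intro k hk
    rw [hu, hF]
    split_ifs <;> omega
  · intro k hk
    rw [hu, hF]
    split_ifs <;> omega
  · intro k l hk hkl
    rw [Fin.lt_def] at *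
    have := l.isLt
    rw [hu, hu, hF, hF]
    split_ifs <;> omega

/-- The maximal representative with low first entry and `s` low values (those below `i`) among
its first `j` entries. -/
lemma exists_rep_low (s : ℕ) (hi : i ≤ n) (hj : j ≤ n) (hs : 1 ≤ s) (hsi : s ≤ i)
    (hsj : s + 1 ≤ j) (hs' : i + j ≤ n + 1 + s) :
    ∃ v : Perm (Fin (n + 1)), IsMaxRep i j v ∧ rk v 1 i = 1 ∧ rk v j i = s := by
  obtain ⟨F, hF⟩ : ∃ F : ℕ → ℕ, ∀ p, F p = if p = 0 then i - 1 else if p + s ≤ j then n + 1 - p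
    else if p < j then i + j - 1 - p - s else if p + i ≤ n + s then n - p + s
    else n - p := ⟨_, fun _ => rfl⟩
  obtain ⟨v, hv⟩ := exists_perm (n := n) (F := F)
    (fun k hk => by rw [hF]; split_ifs <;> omega)
    (fun k hk l hl h => by rw [hF, hF] at h; split_ifs at h <;> omega)
  have h1 : rk v 1 i = 1 := by
    rw [rk_eq_of_forall (lo := 0) (hi := 1) (by omega)]
    intro k
    rw [hv, hF]
    split_ifs <;> omega
  refine ⟨v, isMaxRep_of_forall hv ?_ ?_, h1, ?_⟩
  · intro k hk l hl h h'
    rw [hF] at h' h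
    rw [hF] at h
    split_ifs at h h' <;> omega
  · intro k hk h0 hkj
    rw [hF, hF]
    split_ifs <;> first | omega | contradiction
  · rw [← rk_inv, rk_eq_of_forall (lo := i - s) (hi := i) (by omega)]
    · omega
    intro t
    obtain ⟨k, rfl⟩ := v.surjective t
    rw [Perm.coe_inv, symm_apply_apply, hv, hF]
    split_ifs <;> omega

lemma coversIn_revPerm {X : Set (Perm (Fin (n + 1)))} (hX : ∀ z, z ∈ X ↔ IsMaxRep i j z)
    (hi : i ≤ n + 1) (hj : 1 ≤ j) (hjn : j ≤ n + 1) {u : Perm (Fin (n + 1))}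
    (hu : IsMaxRep i j u)
    (h : rk u 1 i + rk u j i = rk (Fin.revPerm : Perm (Fin (n + 1))) 1 i +
      rk (Fin.revPerm : Perm (Fin (n + 1))) j i + 1) : CoversIn X u Fin.revPerm := by
  refine ⟨(hX u).2 hu, (hX _).2 isMaxRep_revPerm, Bruhat.bruhatLE_of_rk_le (rk_revPerm_le u),
    by rintro rfl; omega, fun z hz huz hzw => ?_⟩
  have hz' := (hX z).1 hz
  have h1 := rk_le_of_bruhatLE huz 1 i
  have h2 := rk_le_of_bruhatLE huz j i
  have h3 := rk_le_of_bruhatLE hzw 1 i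
  have h4 := rk_le_of_bruhatLE hzw j i
  have : (rk u 1 i = rk z 1 i ∧ rk u j i = rk z j i) ∨
      (rk (Fin.revPerm : Perm (Fin (n + 1))) 1 i = rk z 1 i ∧
        rk (Fin.revPerm : Perm (Fin (n + 1))) j i = rk z j i) := by omega
  rcases this with h | h
  · exact Or.inl (hz'.eq_of_rk_eq hu hi hj hjn h.1 h.2)
  · exact Or.inr (hz'.eq_of_rk_eq isMaxRep_revPerm hi hj hjn h.1 h.2)

lemma eq_of_coversIn_revPerm {X : Set (Perm (Fin (n + 1)))} (hX : ∀ z, z ∈ X ↔ IsMaxRep i j z)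
    (hi : i ≤ n + 1) (hj : 1 ≤ j) (hjn : j ≤ n + 1) {u z : Perm (Fin (n + 1))}
    (hu : CoversIn X u Fin.revPerm) (hz : CoversIn X z Fin.revPerm)
    (h1 : rk u 1 i ≤ rk z 1 i) (h2 : rk u j i ≤ rk z j i) : z = u := by
  obtain ⟨huX, -, huw, hne, -⟩ := hu
  have hzu : bruhatLE z u := ((hX u).1 huX).bruhatLE_of_rk_le hi hj hjn h1 h2
  rcases hz.2.2.2.2 u huX hzu huw with h | h
  · exact h.symm
  · exact absurd h hne

lemma rk_lt_of_coversIn_revPerm {X : Set (Perm (Fin (n + 1)))}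
    (hX : ∀ z, z ∈ X ↔ IsMaxRep i j z) (hi : i ≤ n + 1) (hj : 1 ≤ j) (hjn : j ≤ n + 1)
    {z : Perm (Fin (n + 1))} (hz : CoversIn X z Fin.revPerm) :
    rk (Fin.revPerm : Perm (Fin (n + 1))) 1 i < rk z 1 i ∨
      rk (Fin.revPerm : Perm (Fin (n + 1))) j i < rk z j i := by
  by_contra! h
  refine hz.2.2.2.1 (((hX z).1 hz.1).eq_of_rk_eq isMaxRep_revPerm hi hj hjn ?_ ?_)
  · exact (rk_revPerm_le z 1 i).antisymm h.1
  · exact (rk_revPerm_le z j i).antisymm h.2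

end Cosets

end Bruhat

/-- Let `n ≥ 5`, `w₀` the longest element (`Fin.revPerm`), `I = R − {s_i}` with
`2 ≤ i ≤ n−1` and `J = R − {s_1, s_j}` with `2 < j < n−1` (all 1-based).
If `n > i + j − 2`, then `w₀` covers exactly one element of `X⁺_{I,J}`, namely the
permutation `u` with `u(k) = n+2−k` for `1 ≤ k ≤ j−1` (0-based: `u(k) = n−k` for
`k ≤ j−2`), `u(j) = i` (0-based: `u(j−1) = i−1`), and whose entries in positions
`j+1, ..., n+1` (0-based `j, ..., n`) are in decreasing order.  If `n ≤ i + j − 2`,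
then `w₀` covers exactly two elements of `X⁺_{I,J}`. -/
theorem stmt_16 (n : ℕ) (hn : 5 ≤ n) (i j : ℕ)
    (hi1 : 2 ≤ i) (hi2 : i ≤ n - 1) (hj1 : 2 < j) (hj2 : j < n - 1)
    (I J : Set (Fin n))
    (hI : I = ({⟨i - 1, by omega⟩} : Set (Fin n))ᶜ)
    (hJ : J = ({⟨0, by omega⟩, ⟨j - 1, by omega⟩} : Set (Fin n))ᶜ) :
    (i + j - 2 < n →
      ∃ u : Equiv.Perm (Fin (n + 1)),
        CoversIn (Xplus I J) u Fin.revPerm ∧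
        (∀ k : Fin (n + 1), (k : ℕ) ≤ j - 2 → (u k : ℕ) = n - (k : ℕ)) ∧
        (u ⟨j - 1, by omega⟩ : ℕ) = i - 1 ∧
        (∀ k l : Fin (n + 1), j ≤ (k : ℕ) → k < l → u l < u k) ∧
        (∀ z : Equiv.Perm (Fin (n + 1)), CoversIn (Xplus I J) z Fin.revPerm → z = u)) ∧
    (n ≤ i + j - 2 →
      ∃ u v : Equiv.Perm (Fin (n + 1)), u ≠ v ∧
        CoversIn (Xplus I J) u Fin.revPerm ∧ CoversIn (Xplus I J) v Fin.revPerm ∧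
        ∀ z : Equiv.Perm (Fin (n + 1)),
          CoversIn (Xplus I J) z Fin.revPerm → z = u ∨ z = v) := by
  have hX : ∀ y, y ∈ Xplus I J ↔ Bruhat.IsMaxRep i j y := fun y => by
    subst hI hJ
    exact Bruhat.mem_Xplus_iff (by omega) _ (by omega) _ _ y
  have hi : i ≤ n + 1 := by omega
  have hj : 1 ≤ j := by omega
  have hjn : j ≤ n + 1 := by omega
  have hw1 := Bruhat.rk_revPerm (n := n) 1 i (by omega)
  have hwj := Bruhat.rk_revPerm (n := n) j i hjn
  obtain ⟨u, hu, hu1, huj, huhead, hulow, hutail⟩ :=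
    Bruhat.exists_rep_high (n := n) (i := i) (j := j) (j - (n + 1 - i) + 1) (by omega) (by omega)
      (by omega) (by omega) (by omega) (by omega)
  have hucov := Bruhat.coversIn_revPerm hX hi hj hjn hu (by omega)
  refine ⟨fun hlt => ⟨u, hucov, fun k hk => huhead k (by omega), hulow _ (by simp only; omega),
    hutail, fun z hz => ?_⟩, fun hle => ?_⟩
  · refine Bruhat.eq_of_coversIn_revPerm hX hi hj hjn hucov hz (by omega) ?_
    have := Bruhat.rk_mono_left z hj i
    have := Bruhat.rk_lt_of_coversIn_revPerm hX hi hj hjn hz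
    omega
  · obtain ⟨v, hv, hv1, hvj⟩ :=
      Bruhat.exists_rep_low (n := n) (i := i) (j := j) (j - (n + 1 - i)) (by omega) (by omega)
        (by omega) (by omega) (by omega) (by omega)
    have hvcov := Bruhat.coversIn_revPerm hX hi hj hjn hv (by omega)
    refine ⟨u, v, by rintro rfl; omega, hucov, hvcov, fun z hz => ?_⟩
    rcases Bruhat.rk_lt_of_coversIn_revPerm hX hi hj hjn hz with h | h
    · have := Bruhat.rk_le_of_bruhatLE hz.2.2.1 j i
      exact Or.inr (Bruhat.eq_of_coversIn_revPerm hX hi hj hjn hvcov hz (by omega) (by omega))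
    · exact Or.inl (Bruhat.eq_of_coversIn_revPerm hX hi hj hjn hucov hz (by omega) (by omega))
end

section
/- Let n ≥ 1 and W = S_{n+1}, acting on ℝ^{n+1} by permuting coordinates: (w·μ)_k = μ_{w⁻¹(k)}. Let θ ∈ ℝ^{n+1} be dominant, i.e., θ_1 ≥ θ_2 ≥ ⋯ ≥ θ_{n+1}, let J = {s_k ∈ R : θ_k = θ_{k+1}}, and let W^J = {w ∈ W : ℓ(ws) > ℓ(w) for all s ∈ J} be the set of minimal-length representatives of the cosets W/W_J, where W_J (the subgroup generated by J) is the stabilizer of θ. Define a partial order ≤_B on the orbit Wθ as the transitive closure of the relations μ <_B t·μ for transpositions t = (a b) with a < b and μ_a > μ_b. Then the evaluation map w ↦ w·θ is an order isomorphism from W^J with the restriction of the Bruhat order onto (Wθ, ≤_B). -/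
/-- The action of `S_m` on `ℝ^m` by permuting coordinates: `(w·μ)_k = μ_{w⁻¹(k)}`. -/
def act {m : ℕ} (w : Equiv.Perm (Fin m)) (μ : Fin m → ℝ) : Fin m → ℝ :=
  fun k => μ (w⁻¹ k)

theorem sLen_lt_sLen_mul_swap_s18 {m : ℕ} (w : Equiv.Perm (Fin m)) {i j : Fin m} (hij : i < j)
    (hw : w i < w j) : sLen w < sLen (w * Equiv.swap i j) := by
  set t : Equiv.Perm (Fin m) := Equiv.swap i j with ht
  have htt : ∀ p, t (t p) = p := Equiv.swap_apply_self i j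
  let f : Fin m × Fin m → Fin m × Fin m :=
    fun p => if t p.1 < t p.2 then (t p.1, t p.2) else p
  have hf : Set.InjOn f {p | p.1 < p.2} := by
    rintro ⟨p, q⟩ hpq ⟨p', q'⟩ hpq' h
    simp only [Set.mem_ofPred_eq] at hpq hpq'
    simp only [f] at h
    split_ifs at h <;> simp only [Prod.mk.injEq] at h ⊢
    · exact ⟨t.injective h.1, t.injective h.2⟩
    all_goals grind
  rw [sLen, ← Finset.card_image_of_injOn (hf.mono fun p hp => (Finset.mem_filter.1 hp).2.1)]
  refine Finset.card_lt_card (Finset.ssubset_iff_of_subset ?_ |>.2 ⟨(i, j), ?_, ?_⟩)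
  · intro x hx
    obtain ⟨⟨p, q⟩, hpq, rfl⟩ := Finset.mem_image.1 hx
    simp only [Finset.mem_filter, Finset.mem_univ, true_and] at hpq ⊢
    simp only [f]
    split_ifs with h
    · simpa [htt, h] using hpq.2
    · refine ⟨hpq.1, ?_⟩
      simp only [Equiv.Perm.mul_apply]
      rw [ht, Equiv.swap_apply_def, Equiv.swap_apply_def] at h ⊢
      grind
  · simpa [ht] using ⟨hij, hw⟩
  · intro hx
    obtain ⟨⟨p, q⟩, hpq, h⟩ := Finset.mem_image.1 hx
    simp only [Finset.mem_filter, Finset.mem_univ, true_and] at hpq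
    simp only [f] at h
    split_ifs at h with h' <;> simp only [Prod.mk.injEq] at h
    · have hp : p = j := by rw [← htt p, h.1, ht, Equiv.swap_apply_left]
      have hq : q = i := by rw [← htt q, h.2, ht, Equiv.swap_apply_right]
      exact absurd hpq.1 (hp ▸ hq ▸ hij.not_gt)
    · exact absurd hpq.2 (h.1 ▸ h.2 ▸ hw.not_gt)

theorem sLen_lt_sLen_mul_swap_iff {m : ℕ} (w : Equiv.Perm (Fin m)) {i j : Fin m} (hij : i < j) :
    sLen w < sLen (w * Equiv.swap i j) ↔ w i < w j := by
  refine ⟨fun h => ?_, sLen_lt_sLen_mul_swap_s18 w hij⟩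
  by_contra! hji
  have hlt : w j < w i := lt_of_le_of_ne hji (w.injective.ne hij.ne')
  have := sLen_lt_sLen_mul_swap_s18 (w * Equiv.swap i j) hij (by simpa using hlt)
  rw [mul_assoc, Equiv.swap_mul_self, mul_one] at this
  exact this.not_gt h

theorem sLen_lt_sLen_swap_mul_iff {m : ℕ} (w : Equiv.Perm (Fin m)) {a b : Fin m} (hab : a < b) :
    sLen w < sLen (Equiv.swap a b * w) ↔ w⁻¹ a < w⁻¹ b := by
  have key : Equiv.swap a b * w = w * Equiv.swap (w⁻¹ a) (w⁻¹ b) := by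
    rw [Equiv.mul_swap_eq_swap_mul]
    simp
  rcases lt_trichotomy (w⁻¹ a) (w⁻¹ b) with h | h | h
  · rw [key, sLen_lt_sLen_mul_swap_iff w h]
    simp [hab, show w.symm a < w.symm b from h]
  · exact absurd (w⁻¹.injective h) hab.ne
  · rw [key, Equiv.swap_comm, sLen_lt_sLen_mul_swap_iff w h]
    simp [hab.not_gt, show w.symm b ≤ w.symm a from h.le]

theorem act_mul {m : ℕ} (u v : Equiv.Perm (Fin m)) (μ : Fin m → ℝ) :
    act (u * v) μ = act u (act v μ) := by
  ext k
  simp [act]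

theorem act_swap_apply_of_ne {m : ℕ} {a b c : Fin m} (μ : Fin m → ℝ) (ha : c ≠ a) (hb : c ≠ b) :
    act (Equiv.swap a b) μ c = μ c := by
  simp [act, Equiv.swap_apply_of_ne_of_ne ha hb]

theorem act_swap_apply_left {m : ℕ} (a b : Fin m) (μ : Fin m → ℝ) :
    act (Equiv.swap a b) μ a = μ b := by
  simp [act]

theorem act_swap_apply_right {m : ℕ} (a b : Fin m) (μ : Fin m → ℝ) :
    act (Equiv.swap a b) μ b = μ a := by
  simp [act]

theorem act_swap_eq_self {m : ℕ} {a b : Fin m} {μ : Fin m → ℝ} (h : μ a = μ b) :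
    act (Equiv.swap a b) μ = μ := by
  ext k
  simp only [act, Equiv.swap_inv, Equiv.swap_apply_def]
  split_ifs <;> simp_all

theorem act_swap_swap_of_eq_left {m : ℕ} {a b c : Fin m} {μ : Fin m → ℝ} (hac : a ≠ c)
    (hcb : c ≠ b) (hab : a ≠ b) (h : μ c = μ a) :
    act (Equiv.swap a c) (act (Equiv.swap c b) μ) = act (Equiv.swap a b) μ := by
  ext k
  simp only [act, Equiv.swap_inv, Equiv.swap_apply_def]
  grind

theorem act_swap_swap_of_eq_right {m : ℕ} {a b c : Fin m} {μ : Fin m → ℝ} (hac : a ≠ c)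
    (hcb : c ≠ b) (hab : a ≠ b) (h : μ c = μ b) :
    act (Equiv.swap c b) (act (Equiv.swap a c) μ) = act (Equiv.swap a b) μ := by
  ext k
  simp only [act, Equiv.swap_inv, Equiv.swap_apply_def]
  grind

/-- `w` is increasing on the level sets of `θ`. For dominant `θ` this says that `w` is the
minimal-length representative of its coset modulo the stabilizer of `θ`. -/
def IncreasingOnLevels {m : ℕ} (θ : Fin m → ℝ) (w : Equiv.Perm (Fin m)) : Prop :=
  ∀ ⦃i j : Fin m⦄, i < j → θ i = θ j → w i < w j

theorem increasingOnLevels_iff {n : ℕ} {θ : Fin (n + 1) → ℝ} (hθ : Antitone θ)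
    (w : Equiv.Perm (Fin (n + 1))) :
    IncreasingOnLevels θ w ↔ ∀ k : Fin n, θ k.castSucc = θ k.succ →
      sLen w < sLen (w * Equiv.swap k.castSucc k.succ) := by
  simp_rw [sLen_lt_sLen_mul_swap_iff w Fin.castSucc_lt_succ]
  refine ⟨fun h k hk => h Fin.castSucc_lt_succ hk, fun h i j => ?_⟩
  induction j using Fin.induction with
  | zero => exact fun hij => absurd hij (Fin.not_lt_zero i)
  | succ k ih =>
    intro hij hk
    have hik : i ≤ k.castSucc := Fin.le_castSucc_iff.2 hij
    have hle : θ k.succ ≤ θ k.castSucc := hθ Fin.castSucc_lt_succ.le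
    have hki : θ k.castSucc = θ i := le_antisymm (hθ hik) (hk ▸ hle)
    have hlast := h k (hki.trans hk)
    rcases hik.eq_or_lt with rfl | hlt
    · exact hlast
    · exact (ih hlt hki.symm).trans hlast

theorem IncreasingOnLevels.eq_of_act_eq {m : ℕ} {θ : Fin m → ℝ} (hθ : Antitone θ)
    {u v : Equiv.Perm (Fin m)} (hu : IncreasingOnLevels θ u) (hv : IncreasingOnLevels θ v)
    (h : act u θ = act v θ) : u = v := by
  have hσ : ∀ i, θ (v⁻¹ (u i)) = θ i := fun i => by
    simpa [act] using (congrFun h (u i)).symm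
  have hmono : StrictMono (v⁻¹ * u) := by
    intro i j hij
    simp only [Equiv.Perm.mul_apply]
    rcases (hθ hij.le).eq_or_lt with he | hlt
    · by_contra! hle
      have huij := hu hij he.symm
      rcases hle.eq_or_lt with h' | h'
      · exact huij.ne' (v⁻¹.injective h')
      · have := hv h' (by rw [hσ, hσ, he])
        exact huij.not_gt (by simpa using this)
    · by_contra! hle
      have := hθ hle
      rw [hσ, hσ] at this
      exact this.not_gt hlt
  have hone : v⁻¹ * u = 1 := by
    ext1 i
    exact congrArg (fun e : Fin m ≃o Fin m => e i) (Subsingleton.elim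
      (hmono.orderIsoOfSurjective _ (v⁻¹ * u).surjective) (OrderIso.refl _))
  exact (inv_mul_eq_one.1 hone).symm

theorem exists_increasingOnLevels_act_eq {n : ℕ} {θ : Fin (n + 1) → ℝ} (hθ : Antitone θ)
    (w : Equiv.Perm (Fin (n + 1))) : ∃ v, IncreasingOnLevels θ v ∧ act v θ = act w θ := by
  induction hl : sLen w using Nat.strong_induction_on generalizing w with
  | _ l ih =>
    by_cases hw : IncreasingOnLevels θ w
    · exact ⟨w, hw, rfl⟩
    · rw [increasingOnLevels_iff hθ] at hw
      push Not at hw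
      obtain ⟨k, hk, hle⟩ := hw
      have hne : w k.succ ≠ w k.castSucc := w.injective.ne Fin.castSucc_lt_succ.ne'
      have hlt : sLen (w * Equiv.swap k.castSucc k.succ) < sLen w := by
        have h := sLen_lt_sLen_mul_swap_s18 (w * Equiv.swap k.castSucc k.succ)
          (Fin.castSucc_lt_succ (i := k)) (by
            have := mt (sLen_lt_sLen_mul_swap_iff w (Fin.castSucc_lt_succ (i := k))).2 hle.not_gt
            simpa using lt_of_le_of_ne (not_lt.1 this) hne)
        rwa [mul_assoc, Equiv.swap_mul_self, mul_one] at h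
      obtain ⟨v, hv, hvw⟩ := ih _ (hl ▸ hlt) _ rfl
      exact ⟨v, hv, by rw [hvw, act_mul, act_swap_eq_self hk]⟩

theorem IncreasingOnLevels.swap_mul {m : ℕ} {θ : Fin m → ℝ} {u : Equiv.Perm (Fin m)}
    (hu : IncreasingOnLevels θ u) {a b : Fin m} (hab : a < b)
    (hne : act u θ a ≠ act u θ b)
    (hbetween : ∀ c, a < c → c < b → act u θ c ≠ act u θ a ∧ act u θ c ≠ act u θ b) :
    IncreasingOnLevels θ (Equiv.swap a b * u) := by
  intro i j hij he
  have hlt := hu hij he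
  have hval : act u θ (u i) = act u θ (u j) := by simpa [act] using he
  have hi := hbetween (u i)
  have hj := hbetween (u j)
  simp only [Equiv.Perm.mul_apply]
  generalize u i = p at *
  generalize u j = q at *
  generalize act u θ = μ at *
  rw [Equiv.swap_apply_def, Equiv.swap_apply_def]
  grind

theorem IncreasingOnLevels.exists_bruhatLE {m : ℕ} {θ : Fin m → ℝ} (hθ : Antitone θ)
    {u : Equiv.Perm (Fin m)} (hu : IncreasingOnLevels θ u) {a b : Fin m} (hab : a < b)
    (hμ : act u θ b < act u θ a) :
    ∃ v, IncreasingOnLevels θ v ∧ act v θ = act (Equiv.swap a b) (act u θ) ∧ bruhatLE u v := by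
  induction hd : (b : ℕ) - a using Nat.strong_induction_on generalizing u a b with
  | _ d ih =>
    by_cases hc : ∃ c, a < c ∧ c < b ∧ (act u θ c = act u θ a ∨ act u θ c = act u θ b)
    · obtain ⟨c, hac, hcb, hca | hcb'⟩ := hc
      · obtain ⟨v, hv, hvu, huv⟩ := ih _ (by omega) hu hcb (hca ▸ hμ) rfl
        obtain ⟨w, hw, hwv, hvw⟩ := ih _ (by omega) hv hac (by
          rwa [hvu, act_swap_apply_left, act_swap_apply_of_ne _ hac.ne hab.ne]) rfl
        exact ⟨w, hw, by rw [hwv, hvu, act_swap_swap_of_eq_left hac.ne hcb.ne hab.ne hca],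
          huv.trans hvw⟩
      · obtain ⟨v, hv, hvu, huv⟩ := ih _ (by omega) hu hac (hcb' ▸ hμ) rfl
        obtain ⟨w, hw, hwv, hvw⟩ := ih _ (by omega) hv hcb (by
          rwa [hvu, act_swap_apply_right, act_swap_apply_of_ne _ hab.ne' hcb.ne']) rfl
        exact ⟨w, hw, by rw [hwv, hvu, act_swap_swap_of_eq_right hac.ne hcb.ne hab.ne hcb'],
          huv.trans hvw⟩
    · push Not at hc
      refine ⟨Equiv.swap a b * u, hu.swap_mul hab hμ.ne' hc, act_mul _ _ _,
        Relation.ReflTransGen.single ⟨⟨a, b, hab.ne, rfl⟩, ?_⟩⟩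
      rw [sLen_lt_sLen_swap_mul_iff u hab]
      exact hθ.reflect_lt hμ

theorem reflTransGen_act_of_bruhatLE {m : ℕ} {θ : Fin m → ℝ} (hθ : Antitone θ)
    {u v : Equiv.Perm (Fin m)} (h : bruhatLE u v) :
    Relation.ReflTransGen
      (fun μ ν : Fin m → ℝ => ∃ a b : Fin m, a < b ∧ μ b < μ a ∧ ν = act (Equiv.swap a b) μ)
      (act u θ) (act v θ) := by
  refine Relation.ReflTransGen.trans_induction_on h (fun _ => .refl) ?_
    (fun _ _ h₁ h₂ => h₁.trans h₂)
  rintro x y ⟨⟨a, b, hne, rfl⟩, hlt⟩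
  wlog hab : a < b generalizing a b
  · rw [Equiv.swap_comm] at hlt ⊢
    exact this b a hne.symm hlt (lt_of_le_of_ne (not_lt.1 hab) hne.symm)
  have hle : act x θ b ≤ act x θ a := hθ ((sLen_lt_sLen_swap_mul_iff x hab).1 hlt).le
  rw [act_mul]
  rcases hle.eq_or_lt with he | hlt'
  · rw [act_swap_eq_self he.symm]
  · exact .single ⟨a, b, hab, hlt', rfl⟩

theorem IncreasingOnLevels.exists_bruhatLE_of_reflTransGen {m : ℕ} {θ : Fin m → ℝ}
    (hθ : Antitone θ) {u : Equiv.Perm (Fin m)} (hu : IncreasingOnLevels θ u) {ν : Fin m → ℝ}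
    (h : Relation.ReflTransGen
      (fun μ ν : Fin m → ℝ => ∃ a b : Fin m, a < b ∧ μ b < μ a ∧ ν = act (Equiv.swap a b) μ)
      (act u θ) ν) :
    ∃ v, IncreasingOnLevels θ v ∧ act v θ = ν ∧ bruhatLE u v := by
  induction h with
  | refl => exact ⟨u, hu, rfl, .refl⟩
  | tail _ hstep ih =>
    obtain ⟨v, hv, rfl, huv⟩ := ih
    obtain ⟨a, b, hab, hμ, rfl⟩ := hstep
    obtain ⟨w, hw, hwv, hvw⟩ := hv.exists_bruhatLE hθ hab hμ
    exact ⟨w, hw, hwv, huv.trans hvw⟩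

/-- Let `θ` be dominant (`θ_1 ≥ ⋯ ≥ θ_{n+1}`), `J = {s_k : θ_k = θ_{k+1}}`, and
`W^J = {w : ℓ(ws) > ℓ(w) for all s ∈ J}` the minimal-length coset representatives
of `W/W_J`.  Order the orbit `Wθ` by the transitive closure of `μ < t·μ` for
transpositions `t = (a b)`, `a < b`, with `μ_a > μ_b`.  Then `w ↦ w·θ` is an
order isomorphism from `(W^J, Bruhat)` onto `(Wθ, ≤_B)`. -/
theorem stmt_18 (n : ℕ) (hn : 1 ≤ n) (θ : Fin (n + 1) → ℝ)
    (hθ : ∀ k : Fin n, θ k.succ ≤ θ k.castSucc) :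
    Set.BijOn (fun w : Equiv.Perm (Fin (n + 1)) => act w θ)
      {w : Equiv.Perm (Fin (n + 1)) |
        ∀ k : Fin n, θ k.castSucc = θ k.succ →
          sLen w < sLen (w * Equiv.swap k.castSucc k.succ)}
      {μ : Fin (n + 1) → ℝ | ∃ w : Equiv.Perm (Fin (n + 1)), μ = act w θ} ∧
    ∀ u : Equiv.Perm (Fin (n + 1)),
      (∀ k : Fin n, θ k.castSucc = θ k.succ →
        sLen u < sLen (u * Equiv.swap k.castSucc k.succ)) →
      ∀ v : Equiv.Perm (Fin (n + 1)),
        (∀ k : Fin n, θ k.castSucc = θ k.succ →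
          sLen v < sLen (v * Equiv.swap k.castSucc k.succ)) →
        (bruhatLE u v ↔
          Relation.ReflTransGen
            (fun μ ν : Fin (n + 1) → ℝ =>
              ∃ a b : Fin (n + 1), a < b ∧ μ b < μ a ∧ ν = act (Equiv.swap a b) μ)
            (act u θ) (act v θ)) := by
  have hanti : Antitone θ := Fin.antitone_iff_succ_le.2 hθ
  simp_rw [← increasingOnLevels_iff hanti]
  refine ⟨⟨fun w _ => ⟨w, rfl⟩, fun u hu v hv h => hu.eq_of_act_eq hanti hv h, ?_⟩,
    fun u hu v hv => ⟨reflTransGen_act_of_bruhatLE hanti, fun h => ?_⟩⟩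
  · rintro _ ⟨w, rfl⟩
    exact exists_increasingOnLevels_act_eq hanti w
  · obtain ⟨w, hw, hwv, huw⟩ := hu.exists_bruhatLE_of_reflTransGen hanti h
    rwa [← hw.eq_of_act_eq hanti hv hwv]
end
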